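/- arXiv:2602.16319 — 4 statements merged into one kernel-verified Lean document; each statement's English description precedes it below -/
import Mathlib

section
/- For every even integer g ≥ 2, there exists an OF(g+1, g), i.e., a partition of the set of all words of length g+1 and weight 2 over ℤ_{g+1} into g² subsets such that each subset has cardinality g(g+1)/2 and any two distinct words lying in the same subset have Hamming distance at least 3. -/
/-- The weight of a word of length `m` over `ℤ_q` (represented as `Fin q`):
the number of nonzero coordinates. -/
def wordWeight {m q : ℕ} (x : Fin m → Fin q) : ℕ :=
  (Finset.univ.filter (fun i => (x i : ℕ) ≠ 0)).card

/-- The set `H(m)` of all words of length `m` and weight `2` over `ℤ_{g+1}`. -/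
def weightTwoWords (m g : ℕ) : Finset (Fin m → Fin (g + 1)) :=
  Finset.univ.filter (fun x => wordWeight x = 2)

/-- A partition of `H(m)` (words of length `m`, weight `2` over `ℤ_{g+1}`) into
`k` subsets, each of cardinality `s`, with pairwise Hamming distance at least
`3` inside each subset. -/
def HasDist3Partition (m g k s : ℕ) : Prop :=
  ∃ P : Fin k → Finset (Fin m → Fin (g + 1)),
    (∀ i j, i ≠ j → Disjoint (P i) (P j)) ∧
    (Finset.univ.biUnion P = weightTwoWords m g) ∧
    (∀ i, (P i).card = s) ∧
    (∀ i, ∀ x ∈ P i, ∀ y ∈ P i, x ≠ y → 3 ≤ hammingDist x y)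

/-- An `ODAR(m,g)`: a partition of `H(m)` into `g²` subsets, each of
cardinality `C(m,2)` and with pairwise Hamming distance at least 3. -/
def IsODAR (m g : ℕ) : Prop :=
  HasDist3Partition m g (g ^ 2) (m.choose 2)

/-- An `OF(m,g)`: a partition of `H(m)` into `g(m-1)` subsets, each of
cardinality `g·m/2` and with pairwise Hamming distance at least 3. -/
def IsOF (m g : ℕ) : Prop :=
  HasDist3Partition m g (g * (m - 1)) (g * m / 2)

/-- A relation that is functional in both directions and irreflexive has a proper 3-colouring. -/
theorem exists_three_colouring {α : Type*} [Fintype α] (R : α → α → Prop)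
    (h1 : ∀ a b c, R a b → R a c → b = c) (h2 : ∀ a b c, R b a → R c a → b = c)
    (h3 : ∀ a, ¬ R a a) : ∃ c : α → Fin 3, ∀ a b, R a b → c a ≠ c b := by
  classical
  suffices H : ∀ S : Finset α, ∃ c : α → Fin 3, ∀ a ∈ S, ∀ b ∈ S, R a b → c a ≠ c b by
    obtain ⟨c, hc⟩ := H Finset.univ
    exact ⟨c, fun a b => hc a (Finset.mem_univ _) b (Finset.mem_univ _)⟩
  intro S
  induction S using Finset.induction_on with
  | empty => exact ⟨fun _ => 0, by simp⟩
  | insert v S hv ih =>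
    obtain ⟨c, hc⟩ := ih
    have e1 : ∃ y : Fin 3, ∀ b, R v b → c b = y := by
      by_cases h : ∃ b, R v b
      · obtain ⟨b, hb⟩ := h
        exact ⟨c b, fun b' hb' => by rw [h1 _ _ _ hb hb']⟩
      · exact ⟨0, fun b hb => absurd ⟨b, hb⟩ h⟩
    have e2 : ∃ y : Fin 3, ∀ b, R b v → c b = y := by
      by_cases h : ∃ b, R b v
      · obtain ⟨b, hb⟩ := h
        exact ⟨c b, fun b' hb' => by rw [h2 _ _ _ hb hb']⟩
      · exact ⟨0, fun b hb => absurd ⟨b, hb⟩ h⟩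
    obtain ⟨y1, hy1⟩ := e1
    obtain ⟨y2, hy2⟩ := e2
    have e3 : ∀ y1 y2 : Fin 3, ∃ z : Fin 3, z ≠ y1 ∧ z ≠ y2 := by decide
    obtain ⟨z, hz1, hz2⟩ := e3 y1 y2
    refine ⟨fun a => if a = v then z else c a, ?_⟩
    intro a ha b hb hab
    by_cases hav : a = v <;> by_cases hbv : b = v
    · subst hav; subst hbv; exact absurd hab (h3 _)
    · subst hav; simp only [if_true, if_neg hbv]; rw [hy1 b hab]; exact hz1
    · subst hbv; simp only [if_true, if_neg hav]; rw [hy2 a hab]; exact hz2.symm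
    · simp only [if_neg hav, if_neg hbv]
      exact hc a (Finset.mem_of_mem_insert_of_ne ha hav) b
        (Finset.mem_of_mem_insert_of_ne hb hbv) hab

/-- Three pairwise orthogonal Boolean functions of two bits. -/
def ell (c : Fin 3) (a b : Bool) : Bool :=
  if c = 0 then a else if c = 1 then b else xor a b

theorem ell_inj : ∀ (c c' : Fin 3) (a b a' b' : Bool), c ≠ c' → ell c a b = ell c a' b' →
    ell c' a b = ell c' a' b' → a = a' ∧ b = b' := by
  decide

/-- The table built from a labelled tournament. -/
theorem exists_table {V L : Type} [Fintype V] [AddCommGroup L] [Fintype L]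
    (out : V → V → Prop) (d : V → V → L)
    (ht : ∀ i j, i ≠ j → (out i j ↔ ¬ out j i)) (hirr : ∀ i, ¬ out i i)
    (ho : ∀ i j j', out i j → out i j' → d i j = d i j' → j = j')
    (hi : ∀ i j j', out j i → out j' i → d j i = d j' i → j = j') :
    ∃ x : ((L × L) × (Bool × Bool)) → V → V → L × Bool,
      (∀ f i j j', i ≠ j → i ≠ j' → x f i j = x f i j' → j = j') ∧
      (∀ f f' i j, i ≠ j → x f i j = x f' i j → x f j i = x f' j i → f = f') := by
  classical
  have H : ∀ s t : L, ∃ c : V × L → Fin 3, ∀ i j, out i j →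
      c (i, d i j + s) ≠ c (j, d i j + t) := by
    intro s t
    obtain ⟨c, hc⟩ := exists_three_colouring
      (fun (u v : V × L) => out u.1 v.1 ∧ u.2 = d u.1 v.1 + s ∧ v.2 = d u.1 v.1 + t)
      (by
        rintro ⟨i, p⟩ ⟨j, q⟩ ⟨j', q'⟩ ⟨h1, h2, h3⟩ ⟨h4, h5, h6⟩
        simp only at *
        have hd : d i j = d i j' := add_right_cancel (h2.symm.trans h5)
        obtain rfl := ho _ _ _ h1 h4 hd
        rw [h3, h6])
      (by
        rintro ⟨i, p⟩ ⟨j, q⟩ ⟨j', q'⟩ ⟨h1, h2, h3⟩ ⟨h4, h5, h6⟩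
        simp only at *
        have hd : d j i = d j' i := add_right_cancel (h3.symm.trans h6)
        obtain rfl := hi _ _ _ h1 h4 hd
        rw [h2, h5])
      (by rintro ⟨i, p⟩ ⟨h1, _⟩; exact hirr _ h1)
    exact ⟨c, fun i j hij => hc _ _ ⟨hij, rfl, rfl⟩⟩
  choose c hc using H
  refine ⟨fun f i j => if out i j then
      (d i j + f.1.1, ell (c f.1.1 f.1.2 (i, d i j + f.1.1)) f.2.1 f.2.2)
    else (d j i + f.1.2, ! ell (c f.1.1 f.1.2 (i, d j i + f.1.2)) f.2.1 f.2.2), ?_, ?_⟩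
  · rintro ⟨⟨s, t⟩, ⟨a, b⟩⟩ i j j' hj hj' h
    by_cases h1 : out i j <;> by_cases h2 : out i j' <;>
      simp only [h1, h2, if_true, if_false, Prod.mk.injEq] at h
    · exact ho _ _ _ h1 h2 (add_right_cancel h.1)
    · rw [h.1] at h; simp at h
    · rw [h.1] at h; simp at h
    · exact hi i _ _ ((ht _ _ hj.symm).2 h1) ((ht _ _ hj'.symm).2 h2) (add_right_cancel h.1)
  · have key : ∀ (s t s' t' : L) (a b a' b' : Bool) (i j : V), out i j →
        (d i j + s, ell (c s t (i, d i j + s)) a b) =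
          (d i j + s', ell (c s' t' (i, d i j + s')) a' b') →
        (d i j + t, ! ell (c s t (j, d i j + t)) a b) =
          (d i j + t', ! ell (c s' t' (j, d i j + t')) a' b') →
        s = s' ∧ t = t' ∧ a = a' ∧ b = b' := by
      intro s t s' t' a b a' b' i j hij h1 h2
      simp only [Prod.mk.injEq] at h1 h2
      obtain rfl := add_left_cancel h1.1
      obtain rfl := add_left_cancel h2.1
      obtain ⟨rfl, rfl⟩ := ell_inj _ _ a b a' b' (hc s t i j hij) h1.2 (by simpa using h2.2)
      simp
    rintro ⟨⟨s, t⟩, ⟨a, b⟩⟩ ⟨⟨s', t'⟩, ⟨a', b'⟩⟩ i j hij h1 h2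
    by_cases h : out i j
    · have h' : ¬ out j i := (ht _ _ hij).1 h
      simp only [h, h', if_true, if_false] at h1 h2
      obtain ⟨rfl, rfl, rfl, rfl⟩ := key _ _ _ _ _ _ _ _ i j h h1 h2
      rfl
    · have h' : out j i := (ht _ _ hij.symm).2 h
      simp only [h, h', if_true, if_false] at h1 h2
      obtain ⟨rfl, rfl, rfl, rfl⟩ := key _ _ _ _ _ _ _ _ j i h' h2 h1
      rfl

/-- The word of weight two with prescribed entries. -/
def wd {n g : ℕ} (x : Fin n → Fin n → Fin g) (i j : Fin n) : Fin n → Fin (g + 1) :=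
  fun k => if k = i then (x i j).succ else if k = j then (x j i).succ else 0

theorem wd_ne_zero {n g : ℕ} (x : Fin n → Fin n → Fin g) (i j k : Fin n) :
    wd x i j k ≠ 0 ↔ k = i ∨ k = j := by
  unfold wd
  split_ifs <;> simp_all

theorem wd_pair {n g : ℕ} (x y : Fin n → Fin n → Fin g) (i j i' j' : Fin n) (h : i < j)
    (h' : i' < j') (he : wd x i j = wd y i' j') : i = i' ∧ j = j' := by
  have e : ∀ k, (k = i ∨ k = j) ↔ (k = i' ∨ k = j') := by
    intro k
    rw [← wd_ne_zero x, ← wd_ne_zero y, he]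
  have a1 := (e i).1 (Or.inl rfl)
  have a2 := (e j).1 (Or.inr rfl)
  have a3 := (e i').2 (Or.inl rfl)
  have a4 := (e j').2 (Or.inr rfl)
  grind

theorem wd_comm {n g : ℕ} (x : Fin n → Fin n → Fin g) (i j : Fin n) :
    wd x i j = wd x j i := by
  funext k
  unfold wd
  split_ifs with h1 h2 <;> simp_all

theorem three_le_dist {n q : ℕ} (u v : Fin n → Fin q) (a b c : Fin n) (hab : a ≠ b)
    (hac : a ≠ c) (hbc : b ≠ c) (ha : u a ≠ v a) (hb : u b ≠ v b) (hc : u c ≠ v c) :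
    3 ≤ hammingDist u v := by
  have h : ({a, b, c} : Finset (Fin n)).card = 3 := by
    rw [Finset.card_eq_three]; exact ⟨a, b, c, hab, hac, hbc, rfl⟩
  rw [← h]
  unfold hammingDist
  apply Finset.card_le_card
  intro k hk
  simp only [Finset.mem_insert, Finset.mem_singleton] at hk
  rcases hk with rfl | rfl | rfl <;> simp [*]

/-- Distance for two words sharing exactly one support position. -/
theorem wd_dist_shared {n g : ℕ} (x : Fin n → Fin n → Fin g)
    (h1 : ∀ i j j', i ≠ j → i ≠ j' → x i j = x i j' → j = j')
    (i j j' : Fin n) (h : i ≠ j) (h' : i ≠ j') (hj : j ≠ j') :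
    3 ≤ hammingDist (wd x i j) (wd x i j') := by
  apply three_le_dist _ _ i j j' h h' hj
  · intro e
    simp only [wd, if_true] at e
    exact hj (h1 _ _ _ h h' (Fin.succ_injective _ e))
  · intro e
    have := (wd_ne_zero x i j j).2 (Or.inr rfl)
    rw [e, wd_ne_zero] at this
    grind
  · intro e
    have := (wd_ne_zero x i j' j').2 (Or.inr rfl)
    rw [← e, wd_ne_zero] at this
    grind

theorem wd_dist {n g : ℕ} (x : Fin n → Fin n → Fin g)
    (h1 : ∀ i j j', i ≠ j → i ≠ j' → x i j = x i j' → j = j')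
    (i j i' j' : Fin n) (h : i ≠ j) (h' : i' ≠ j') (hne : wd x i j ≠ wd x i' j') :
    3 ≤ hammingDist (wd x i j) (wd x i' j') := by
  by_cases e1 : i = i'
  · subst e1
    exact wd_dist_shared x h1 _ _ _ h h' (by rintro rfl; exact hne rfl)
  by_cases e2 : i = j'
  · subst e2
    rw [wd_comm x i' i] at hne ⊢
    exact wd_dist_shared x h1 _ _ _ h h'.symm (by rintro rfl; exact hne rfl)
  by_cases e3 : j = i'
  · subst e3
    rw [wd_comm x i j] at hne ⊢
    exact wd_dist_shared x h1 _ _ _ h.symm h' (by rintro rfl; exact hne rfl)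
  by_cases e4 : j = j'
  · subst e4
    rw [wd_comm x i j, wd_comm x i' j] at hne ⊢
    exact wd_dist_shared x h1 _ _ _ h.symm h'.symm (by rintro rfl; exact hne rfl)
  apply three_le_dist _ _ i j i' h e1 e3
  · intro e
    have := (wd_ne_zero x i j i).2 (Or.inl rfl)
    rw [e, wd_ne_zero] at this
    grind
  · intro e
    have := (wd_ne_zero x i j j).2 (Or.inr rfl)
    rw [e, wd_ne_zero] at this
    grind
  · intro e
    have := (wd_ne_zero x i' j' i').2 (Or.inl rfl)
    rw [← e, wd_ne_zero] at this
    grind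

theorem card_lt_pairs (n : ℕ) :
    (Finset.univ.filter (fun p : Fin n × Fin n => p.1 < p.2)).card = n.choose 2 := by
  have h1 : (Finset.univ.filter (fun p : Fin n × Fin n => p.1 < p.2)).card =
      ∑ j : Fin n, (Finset.univ.filter (fun i : Fin n => i < j)).card := by
    rw [Finset.card_filter, Fintype.sum_prod_type_right]
    simp only [Finset.card_filter]
  rw [h1]
  have h2 : ∀ j : Fin n, (Finset.univ.filter (fun i : Fin n => i < j)).card = (j : ℕ) := by
    intro j
    rw [← Fin.card_Iio j]
    congr 1
    ext; simp
  simp only [h2]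
  rw [Fin.sum_univ_eq_sum_range (fun k => k) n, Finset.sum_range_id, Nat.choose_two_right]

theorem isOF_of_table {g : ℕ} {F : Type} [Fintype F] (hF : Fintype.card F = g * g)
    (x : F → Fin (g + 1) → Fin (g + 1) → Fin g)
    (h1 : ∀ f i j j', i ≠ j → i ≠ j' → x f i j = x f i j' → j = j')
    (h2 : ∀ f f' i j, i ≠ j → x f i j = x f' i j → x f j i = x f' j i → f = f') :
    IsOF (g + 1) g := by
  classical
  have hF' : Fintype.card F = g * (g + 1 - 1) := by rw [hF]; rfl
  let e := Fintype.equivFinOfCardEq hF'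
  refine ⟨fun k => (Finset.univ.filter
    (fun p : Fin (g + 1) × Fin (g + 1) => p.1 < p.2)).image
      (fun p => wd (x (e.symm k)) p.1 p.2), ?_, ?_, ?_, ?_⟩
  · intro k k' hk
    rw [Finset.disjoint_left]
    intro w hw hw'
    simp only [Finset.mem_image, Finset.mem_filter, Finset.mem_univ, true_and] at hw hw'
    obtain ⟨⟨i, j⟩, hij, rfl⟩ := hw
    obtain ⟨⟨i', j'⟩, hij', he⟩ := hw'
    simp only at hij hij' he
    obtain ⟨rfl, rfl⟩ := wd_pair _ _ _ _ _ _ hij' hij he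
    apply hk
    apply e.symm.injective
    apply h2 _ _ i' j' hij.ne
    · have := congrFun he i'
      simp only [wd, if_true] at this
      exact (Fin.succ_injective _ this).symm
    · have := congrFun he j'
      simp only [wd, if_true, if_neg hij.ne'] at this
      exact (Fin.succ_injective _ this).symm
  · ext w
    simp only [Finset.mem_biUnion, Finset.mem_image, Finset.mem_filter, Finset.mem_univ,
      true_and, weightTwoWords]
    unfold wordWeight
    have hz : ∀ k, ((w k : ℕ) ≠ 0) ↔ w k ≠ 0 := by
      intro k; rw [Ne, Ne, Fin.ext_iff]; rfl
    simp only [hz]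
    constructor
    · rintro ⟨k, ⟨i, j⟩, hij, rfl⟩
      simp only at hij
      simp only [wd_ne_zero]
      rw [Finset.card_eq_two]
      refine ⟨i, j, hij.ne, ?_⟩
      ext; simp
    · intro hw
      rw [Finset.card_eq_two] at hw
      obtain ⟨i, j, hij, hs⟩ := hw
      have hs' : ∀ k, w k ≠ 0 ↔ k = i ∨ k = j := by
        intro k
        have := congrArg (k ∈ ·) hs
        simpa using this
      have hinj : Function.Injective (fun f => (x f i j, x f j i)) := by
        intro f f' hff
        simp only [Prod.mk.injEq] at hff
        exact h2 _ _ i j hij hff.1 hff.2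
      have hbij := (Fintype.bijective_iff_injective_and_card
        (fun f => (x f i j, x f j i))).2 ⟨hinj, by simp [hF]⟩
      obtain ⟨f, hf⟩ := hbij.2
        ((w i).pred ((hs' i).2 (Or.inl rfl)), (w j).pred ((hs' j).2 (Or.inr rfl)))
      simp only [Prod.mk.injEq] at hf
      have hw : wd (x f) i j = w := by
        funext k
        unfold wd
        split_ifs with a b
        · subst a; rw [hf.1, Fin.succ_pred]
        · subst b; rw [hf.2, Fin.succ_pred]
        · by_contra hk
          have := (hs' k).1 (Ne.symm hk)
          tauto
      rcases lt_or_gt_of_ne hij with hlt | hlt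
      · exact ⟨e f, (i, j), hlt, by simpa using hw⟩
      · exact ⟨e f, (j, i), hlt, by rw [wd_comm]; simpa using hw⟩
  · intro k
    rw [Finset.card_image_of_injOn, card_lt_pairs, Nat.choose_two_right, mul_comm]
    · rfl
    · rintro ⟨i, j⟩ hij ⟨i', j'⟩ hij' he
      simp only [Finset.coe_filter, Finset.mem_univ, true_and, Set.mem_setOf_eq] at hij hij'
      obtain ⟨rfl, rfl⟩ := wd_pair _ _ _ _ _ _ hij hij' he
      rfl
  · intro k u hu v hv huv
    simp only [Finset.mem_image, Finset.mem_filter, Finset.mem_univ, true_and] at hu hv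
    obtain ⟨⟨i, j⟩, hij, rfl⟩ := hu
    obtain ⟨⟨i', j'⟩, hij', rfl⟩ := hv
    exact wd_dist _ (h1 _) _ _ _ _ hij.ne hij'.ne huv

theorem cast_inj_aux (h a b : ℕ) (ha : 1 ≤ a) (ha' : a ≤ h) (hb : 1 ≤ b) (hb' : b ≤ h)
    (e : (a : ZMod h) = (b : ZMod h)) : a = b := by
  rw [ZMod.natCast_eq_natCast_iff] at e
  rcases le_total a b with l | l
  · have := (Nat.modEq_iff_dvd' l).1 e
    have := Nat.eq_zero_of_dvd_of_lt this (by omega)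
    omega
  · have := (Nat.modEq_iff_dvd' l).1 e.symm
    have := Nat.eq_zero_of_dvd_of_lt this (by omega)
    omega

/-- For every even `g ≥ 2`, an `OF(g+1, g)` exists. -/
theorem exists_OF_succ_of_even (g : ℕ) (hg2 : 2 ≤ g) (hge : Even g) :
    IsOF (g + 1) g := by
  obtain ⟨h, rfl⟩ := hge
  haveI : NeZero h := ⟨by omega⟩
  let D : Fin (h + h + 1) → Fin (h + h + 1) → ℕ := fun i j =>
    if (i : ℕ) ≤ j then (j : ℕ) - i else (j : ℕ) + (h + h + 1) - i
  have hD : ∀ i j, D i j =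
    if (i : ℕ) ≤ j then (j : ℕ) - i else (j : ℕ) + (h + h + 1) - i := fun _ _ => rfl
  obtain ⟨x, hx1, hx2⟩ := exists_table (L := ZMod h)
    (fun i j => 1 ≤ D i j ∧ D i j ≤ h) (fun i j => (D i j : ZMod h))
    (by
      intro i j hij
      have hi := i.2
      have hj := j.2
      rw [Ne, Fin.ext_iff] at hij
      simp only [hD]
      split_ifs <;> omega)
    (by intro i; simp [hD])
    (by
      intro i j j' h1 h2 e
      have := cast_inj_aux h _ _ h1.1 h1.2 h2.1 h2.2 e
      have hi := i.2
      have hj := j.2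
      have hj' := j'.2
      simp only [hD] at this
      rw [Fin.ext_iff]
      split_ifs at this <;> omega)
    (by
      intro i j j' h1 h2 e
      have := cast_inj_aux h _ _ h1.1 h1.2 h2.1 h2.2 e
      have hi := i.2
      have hj := j.2
      have hj' := j'.2
      simp only [hD] at this
      rw [Fin.ext_iff]
      split_ifs at this <;> omega)
  have hc : Fintype.card (ZMod h × Bool) = h + h := by simp [ZMod.card]; ring
  let e := Fintype.equivFinOfCardEq hc
  refine isOF_of_table (F := (ZMod h × ZMod h) × (Bool × Bool)) (by simp [ZMod.card]; ring)
    (fun f i j => e (x f i j)) ?_ ?_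
  · intro f i j j' a b c
    exact hx1 f i j j' a b (e.injective c)
  · intro f f' i j a b c
    exact hx2 f f' i j a (e.injective b) (e.injective c)
end

section
/- For every odd integer g ≥ 3 and every odd integer n with n ≥ g, there exists an OF(2n, g). -/
/-- Perfect matching in a nonempty-degree regular bipartite multigraph, edges `E`. -/
lemma konig_matching {ε α β : Type*} [DecidableEq ε] [Fintype α] [Fintype β] [DecidableEq α]
    [DecidableEq β] (L : ε → α) (R : ε → β) (k : ℕ) (hk : 0 < k) (E : Finset ε)
    (hL : ∀ a, (E.filter (fun e => L e = a)).card = k)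
    (hR : ∀ b, (E.filter (fun e => R e = b)).card = k) :
    ∃ m : α → ε, (∀ a, m a ∈ E) ∧ (∀ a, L (m a) = a) ∧
      Function.Bijective (fun a => R (m a)) := by
  classical
  have hcard : Fintype.card α = Fintype.card β := by
    have h1 : E.card = Fintype.card α * k := by
      rw [Finset.card_eq_sum_card_fiberwise (f := L) (t := Finset.univ) (by simp)]
      simp [hL]
    have h2 : E.card = Fintype.card β * k := by
      rw [Finset.card_eq_sum_card_fiberwise (f := R) (t := Finset.univ) (by simp)]
      simp [hR]
    exact Nat.eq_of_mul_eq_mul_right hk (h1.symm.trans h2)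
  let t : α → Finset β := fun a => (E.filter (fun e => L e = a)).image R
  have hall : ∀ s : Finset α, s.card ≤ (s.biUnion t).card := by
    intro s
    have h1 : (E.filter (fun e => L e ∈ s)).card = s.card * k := by
      rw [Finset.card_eq_sum_card_fiberwise (f := L) (t := s)
        (by intro e he; simpa using (Finset.mem_filter.1 he).2)]
      rw [Finset.sum_congr rfl (g := fun _ => k)]
      · simp
      · intro a ha
        rw [← hL a, Finset.filter_filter]
        congr 1
        ext e
        simp only [Finset.mem_filter]
        constructor
        · rintro ⟨h, _, h'⟩; exact ⟨h, h'⟩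
        · rintro ⟨h, h'⟩; exact ⟨h, h' ▸ ha, h'⟩
    have h2 : (E.filter (fun e => L e ∈ s)).card ≤ (E.filter (fun e => R e ∈ s.biUnion t)).card := by
      apply Finset.card_le_card
      intro e he
      simp only [Finset.mem_filter] at he ⊢
      refine ⟨he.1, ?_⟩
      rw [Finset.mem_biUnion]
      exact ⟨L e, he.2, Finset.mem_image.2 ⟨e, by simp [he.1], rfl⟩⟩
    have h3 : (E.filter (fun e => R e ∈ s.biUnion t)).card ≤ (s.biUnion t).card * k := by
      rw [Finset.card_eq_sum_card_fiberwise (f := R) (t := s.biUnion t)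
        (by intro e he; simpa using (Finset.mem_filter.1 he).2)]
      rw [← smul_eq_mul]
      apply Finset.sum_le_card_nsmul
      intro b hb
      rw [← hR b, Finset.filter_filter]
      apply Finset.card_le_card
      intro e he
      simp only [Finset.mem_filter] at he ⊢
      exact ⟨he.1, he.2.2⟩
    rw [h1] at h2
    exact Nat.le_of_mul_le_mul_right (h2.trans h3) hk
  obtain ⟨f, hf, hft⟩ := (Finset.all_card_le_biUnion_card_iff_exists_injective t).1 hall
  have hc : ∀ a, ∃ e, e ∈ E ∧ L e = a ∧ R e = f a := by
    intro a
    obtain ⟨e, he, h⟩ := Finset.mem_image.1 (hft a)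
    exact ⟨e, (Finset.mem_filter.1 he).1, (Finset.mem_filter.1 he).2, h⟩
  choose m h1 h2 h3 using hc
  refine ⟨m, h1, h2, ?_⟩
  have : (fun a => R (m a)) = f := funext h3
  rw [this, Fintype.bijective_iff_injective_and_card]
  exact ⟨hf, hcard⟩

/-- König: a `k`-regular bipartite multigraph has a proper edge colouring with `k` colours. -/
lemma konig_colouring {ε α β : Type*} [DecidableEq ε] [Fintype α] [Fintype β] [DecidableEq α]
    [DecidableEq β] (L : ε → α) (R : ε → β) (k : ℕ) : ∀ (E : Finset ε),
    (∀ a, (E.filter (fun e => L e = a)).card = k) →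
    (∀ b, (E.filter (fun e => R e = b)).card = k) →
    ∃ f : ε → ℕ, (∀ e ∈ E, f e < k) ∧
      (∀ e ∈ E, ∀ e' ∈ E, f e = f e' → L e = L e' → e = e') ∧
      (∀ e ∈ E, ∀ e' ∈ E, f e = f e' → R e = R e' → e = e') := by
  classical
  induction k with
  | zero =>
    intro E hL _
    have hE : E = ∅ := by
      apply Finset.eq_empty_of_forall_notMem
      intro e he
      have := Finset.card_eq_zero.1 (hL (L e))
      have h2 : e ∈ E.filter (fun e' => L e' = L e) := by simp [he]
      rw [this] at h2
      simp at h2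
    subst hE
    exact ⟨fun _ => 0, by simp⟩
  | succ k ih =>
    intro E hL hR
    obtain ⟨m, hmE, hmL, hmR⟩ := konig_matching L R (k+1) (by omega) E hL hR
    let D := Finset.univ.image m
    have hD : ∀ e, e ∈ D ↔ ∃ a, m a = e := by intro e; simp [D]
    obtain ⟨f, hf1, hf2, hf3⟩ := ih (E \ D) (by
      intro a
      have : (E \ D).filter (fun e => L e = a) = (E.filter (fun e => L e = a)).erase (m a) := by
        ext e
        simp only [Finset.mem_filter, Finset.mem_sdiff, Finset.mem_erase, hD]
        constructor
        · rintro ⟨⟨h1, h2⟩, h3⟩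
          exact ⟨fun h => h2 ⟨a, h.symm⟩, h1, h3⟩
        · rintro ⟨h1, h2, h3⟩
          refine ⟨⟨h2, ?_⟩, h3⟩
          rintro ⟨a', rfl⟩
          rw [hmL] at h3
          exact h1 (by rw [h3])
      rw [this, Finset.card_erase_of_mem (by simp [hmE, hmL]), hL]
      simp) (by
      intro b
      obtain ⟨a, ha⟩ := hmR.2 b
      simp only at ha
      have : (E \ D).filter (fun e => R e = b) = (E.filter (fun e => R e = b)).erase (m a) := by
        ext e
        simp only [Finset.mem_filter, Finset.mem_sdiff, Finset.mem_erase, hD]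
        constructor
        · rintro ⟨⟨h1, h2⟩, h3⟩
          exact ⟨fun h => h2 ⟨a, h.symm⟩, h1, h3⟩
        · rintro ⟨h1, h2, h3⟩
          refine ⟨⟨h2, ?_⟩, h3⟩
          rintro ⟨a', rfl⟩
          have : a' = a := hmR.1 (h3.trans ha.symm)
          exact h1 (by rw [this])
      rw [this, Finset.card_erase_of_mem (by simp [hmE, ha]), hR]
      simp)
    refine ⟨fun e => if e ∈ D then k else f e, ?_, ?_, ?_⟩
    · intro e he
      by_cases h : e ∈ D
      · simp [h]
      · simp only [h, if_false]
        have := hf1 e (by simp [he, h])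
        omega
    · intro e he e' he' h hl
      by_cases h1 : e ∈ D <;> by_cases h2 : e' ∈ D <;> simp only [h1, h2, if_true, if_false] at h
      · obtain ⟨a, rfl⟩ := (hD e).1 h1
        obtain ⟨a', rfl⟩ := (hD e').1 h2
        rw [hmL, hmL] at hl
        rw [hl]
      · have := hf1 e' (by simp [he', h2]); omega
      · have := hf1 e (by simp [he, h1]); omega
      · exact hf2 e (by simp [he, h1]) e' (by simp [he', h2]) h hl
    · intro e he e' he' h hl
      by_cases h1 : e ∈ D <;> by_cases h2 : e' ∈ D <;> simp only [h1, h2, if_true, if_false] at h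
      · obtain ⟨a, rfl⟩ := (hD e).1 h1
        obtain ⟨a', rfl⟩ := (hD e').1 h2
        rw [hmR.1 hl]
      · have := hf1 e' (by simp [he', h2]); omega
      · have := hf1 e (by simp [he, h1]); omega
      · exact hf3 e (by simp [he, h1]) e' (by simp [he', h2]) h hl

/-- Detachment: labels at both ends of all edges of an edge-coloured multigraph. -/
lemma detachment {I K : Type*} [Fintype I] [DecidableEq I] [Fintype K] [DecidableEq K] (g : ℕ)
    (W : K → I → I → Prop) [∀ c i j, Decidable (W c i j)]
    (hdeg : ∀ c i, (Finset.univ.filter (fun j => j ≠ i ∧ W c i j)).card = g)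
    (hsym : ∀ c i j, W c i j → W c j i)
    (lam0 : I → K → I → Fin g)
    (h0 : ∀ i j, j ≠ i → ∀ a,
      (Finset.univ.filter (fun c => W c i j ∧ lam0 i c j = a)).card = g) (S : Finset I) :
    ∃ lam : I → K → I → Fin g,
      (∀ i j, j ≠ i → ∀ a, (Finset.univ.filter (fun c => W c i j ∧ lam i c j = a)).card = g) ∧
      (∀ i ∈ S, ∀ c j j', j ≠ i → j' ≠ i → W c i j → W c i j' → lam i c j = lam i c j' → j = j') ∧
      (∀ i ∈ S, ∀ j ∈ S, j ≠ i → ∀ c c', W c i j → W c' i j → lam i c j = lam i c' j →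
        lam j c i = lam j c' i → c = c') := by
  classical
  induction S using Finset.induction_on with
  | empty => exact ⟨lam0, h0, by simp, by simp⟩
  | insert i S hi ih =>
    obtain ⟨lam, H1, H2, H3⟩ := ih
    let E : Finset (K × {j : I // j ≠ i}) := Finset.univ.filter (fun e => W e.1 i e.2.1)
    have hE : ∀ e, e ∈ E ↔ W e.1 i e.2.1 := by intro e; simp [E]
    obtain ⟨f, hf1, hf2, hf3⟩ := konig_colouring (fun e : K × {j : I // j ≠ i} => e.1)
      (fun e : K × {j : I // j ≠ i} => (e.2, lam e.2.1 e.1 i)) g E (by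
        intro c
        rw [← hdeg c i]
        refine Finset.card_bij (fun e _ => e.2.1) ?_ ?_ ?_
        · rintro ⟨c', j, hj⟩ he
          simp only [Finset.mem_filter, hE] at he
          obtain ⟨he, rfl⟩ := he
          simp [hj, he]
        · rintro ⟨c', j, hj⟩ he ⟨c'', j', hj'⟩ he' h
          simp only [Finset.mem_filter, hE] at he he' h
          obtain ⟨-, rfl⟩ := he
          obtain ⟨-, rfl⟩ := he'
          subst h; rfl
        · intro j hj
          simp only [Finset.mem_filter, Finset.mem_univ, true_and] at hj
          exact ⟨(c, ⟨j, hj.1⟩), by simp [hE, hj.2], rfl⟩) (by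
        rintro ⟨⟨j, hj⟩, a⟩
        refine Eq.trans ?_ (H1 j i (Ne.symm hj) a)
        refine Finset.card_bij (fun e _ => e.1) ?_ ?_ ?_
        · rintro ⟨c', j', hj'⟩ he
          simp only [Finset.mem_filter, hE, Prod.mk.injEq, Subtype.mk.injEq] at he
          obtain ⟨he, rfl, h2⟩ := he
          simp [hsym _ _ _ he, h2]
        · rintro ⟨c', j', hj'⟩ he ⟨c'', j'', hj''⟩ he' h
          simp only [Finset.mem_filter, hE, Prod.mk.injEq, Subtype.mk.injEq] at he he' h
          obtain ⟨-, rfl, -⟩ := he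
          obtain ⟨-, rfl, -⟩ := he'
          subst h; rfl
        · intro c hc
          simp only [Finset.mem_filter, Finset.mem_univ, true_and] at hc
          exact ⟨(c, ⟨j, hj⟩), by simp [hE, hsym _ _ _ hc.1, hc.2], rfl⟩)
    let mu : K → I → Fin g := fun c j =>
      if h : j ≠ i then (if h' : W c i j then ⟨f (c, ⟨j, h⟩), hf1 _ ((hE _).2 h')⟩ else lam i c j)
      else lam i c j
    have hmu : ∀ c j (h : j ≠ i), W c i j → ((mu c j : Fin g) : ℕ) = f (c, ⟨j, h⟩) := by
      intro c j h h'
      simp only [mu, dif_pos h, dif_pos h']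
    have hmuL : ∀ c j j', j ≠ i → j' ≠ i → W c i j → W c i j' → mu c j = mu c j' → j = j' := by
      intro c j j' h h' w w' e
      have e' := congrArg Fin.val e
      rw [hmu c j h w, hmu c j' h' w'] at e'
      have := hf2 _ ((hE _).2 w) _ ((hE _).2 w') e' rfl
      simpa using this
    have hmuR : ∀ j, j ≠ i → ∀ c c', W c i j → W c' i j → mu c j = mu c' j →
        lam j c i = lam j c' i → c = c' := by
      intro j h c c' w w' e e2
      have e' := congrArg Fin.val e
      rw [hmu c j h w, hmu c' j h w'] at e'
      have := hf3 _ ((hE _).2 w) _ ((hE _).2 w') e' (by simp [e2])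
      simpa using this
    have hmuC : ∀ j, j ≠ i → ∀ a, (Finset.univ.filter (fun c => W c i j ∧ mu c j = a)).card = g := by
      intro j hj
      have hle : ∀ a, (Finset.univ.filter (fun c => W c i j ∧ mu c j = a)).card ≤ g := by
        intro a
        calc _ ≤ (Finset.univ : Finset (Fin g)).card := by
              apply Finset.card_le_card_of_injOn (fun c => lam j c i) (by simp)
              intro c hc c' hc' h
              simp at hc hc'
              exact hmuR j hj c c' hc.1 hc'.1 (hc.2.trans hc'.2.symm) h
          _ = g := by simp
      have htot : (Finset.univ.filter (fun c => W c i j)).card = g * g := by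
        rw [Finset.card_eq_sum_card_fiberwise (f := fun c => lam i c j) (t := Finset.univ) (by simp)]
        simp only [Finset.filter_filter]
        rw [Finset.sum_congr rfl (fun a _ => H1 i j hj a)]
        simp
      have htot2 : ∑ a : Fin g, (Finset.univ.filter (fun c => W c i j ∧ mu c j = a)).card
          = ∑ a : Fin g, g := by
        rw [Finset.card_eq_sum_card_fiberwise (f := fun c => mu c j) (t := Finset.univ) (by simp)]
          at htot
        simp only [Finset.filter_filter] at htot
        rw [htot]; simp
      intro a
      exact (Finset.sum_eq_sum_iff_of_le (fun a _ => hle a)).1 htot2 a (Finset.mem_univ _)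
    refine ⟨Function.update lam i mu, ?_, ?_, ?_⟩
    · intro i' j hj a
      by_cases h : i' = i
      · subst h; simpa using hmuC j hj a
      · simpa [Function.update_of_ne h] using H1 i' j hj a
    · intro i' hi' c j j'
      by_cases h : i' = i
      · subst h; simpa using hmuL c j j'
      · have : i' ∈ S := by simpa [h] using hi'
        simpa [Function.update_of_ne h] using H2 i' this c j j'
    · intro i' hi' j hj' hj c c'
      by_cases h : i' = i
      · subst h
        simpa [Function.update_of_ne hj] using hmuR j hj c c'
      · have hS : i' ∈ S := by simpa [h] using hi'
        by_cases h2 : j = i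
        · subst h2
          simp only [Function.update_of_ne h, Function.update_self]
          intro w w' e e'
          exact hmuR i' h c c' (hsym _ _ _ w) (hsym _ _ _ w') e' e
        · have hS2 : j ∈ S := by simpa [h2] using hj'
          simpa [Function.update_of_ne h, Function.update_of_ne h2] using H3 i' hS j hS2 hj c c'

/-- The standard one-factorization of `K_{M+1}`, `M` odd. -/
def factorIdx (M : ℕ) (i j : Fin (M + 1)) : ZMod M :=
  if (i : ℕ) = M then 2 * ((j : ℕ) : ZMod M)
  else if (j : ℕ) = M then 2 * ((i : ℕ) : ZMod M)
  else ((i : ℕ) : ZMod M) + ((j : ℕ) : ZMod M)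

lemma factorIdx_symm (M : ℕ) (i j : Fin (M + 1)) : factorIdx M i j = factorIdx M j i := by
  unfold factorIdx
  split_ifs with h1 h2
  · rw [h1, h2]
  · rfl
  · rfl
  · ring

lemma zmod_cast_inj {M a b : ℕ} (ha : a < M) (hb : b < M) (h : (a : ZMod M) = (b : ZMod M)) :
    a = b := by
  rw [ZMod.natCast_eq_natCast_iff] at h
  exact Nat.ModEq.eq_of_lt_of_lt h ha hb

lemma factorIdx_inj (M : ℕ) (hM : Odd M) (i j j' : Fin (M + 1)) (hj : j ≠ i) (hj' : j' ≠ i)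
    (h : factorIdx M i j = factorIdx M i j') : j = j' := by
  have hi := i.2
  have hjl := j.2
  have hjl' := j'.2
  have hn : (j : ℕ) ≠ i := fun h => hj (Fin.ext h)
  have hn' : (j' : ℕ) ≠ i := fun h => hj' (Fin.ext h)
  apply Fin.ext
  unfold factorIdx at h
  by_cases h1 : (i : ℕ) = M
  · simp only [h1, if_true] at h
    have h' : ((2 * (j : ℕ) : ℕ) : ZMod M) = ((2 * (j' : ℕ) : ℕ) : ZMod M) := by
      push_cast; exact h
    rw [ZMod.natCast_eq_natCast_iff] at h'
    have hc : Nat.gcd M 2 = 1 := Nat.coprime_two_right.2 hM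
    exact Nat.ModEq.eq_of_lt_of_lt (Nat.ModEq.cancel_left_of_coprime hc h') (by omega) (by omega)
  · simp only [h1, if_false] at h
    by_cases h2 : (j : ℕ) = M <;> by_cases h3 : (j' : ℕ) = M <;>
      simp only [h2, h3, if_true, if_false] at h
    · omega
    · have : ((i : ℕ) : ZMod M) = ((j' : ℕ) : ZMod M) := by linear_combination h
      have := zmod_cast_inj (by omega) (by omega) this
      omega
    · have : ((i : ℕ) : ZMod M) = ((j : ℕ) : ZMod M) := by linear_combination -h
      have := zmod_cast_inj (by omega) (by omega) this
      omega
    · have : ((j : ℕ) : ZMod M) = ((j' : ℕ) : ZMod M) := by linear_combination h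
      exact zmod_cast_inj (by omega) (by omega) this

lemma card_window (M g : ℕ) [NeZero M] (hg : g ≤ M) :
    (Finset.univ.filter (fun x : ZMod M => x.val < g)).card = g := by
  rw [← Finset.card_range g]
  refine Finset.card_bij (fun x _ => x.val) ?_ ?_ ?_
  · intro x hx; simpa using hx
  · intro x _ y _ h; exact ZMod.val_injective M h
  · intro a ha
    have ha' : a < g := by simpa using ha
    refine ⟨(a : ZMod M), ?_, ZMod.val_natCast_of_lt (by omega)⟩
    simp [ZMod.val_natCast_of_lt (show a < M by omega), ha']

lemma exists_labels (M g : ℕ) (hM : Odd M) (hg : g ≤ M) :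
    ∃ (W : (ZMod M × Fin g) → Fin (M + 1) → Fin (M + 1) → Prop)
      (lam : Fin (M + 1) → (ZMod M × Fin g) → Fin (M + 1) → Fin g),
      (∀ c i j, W c i j → W c j i) ∧
      (∀ i c a, ∃ j, j ≠ i ∧ W c i j ∧ lam i c j = a) ∧
      (∀ i c j j', j ≠ i → j' ≠ i → W c i j → W c i j' → lam i c j = lam i c j' → j = j') ∧
      (∀ i j, j ≠ i → ∀ a b, ∃ c, W c i j ∧ lam i c j = a ∧ lam j c i = b) ∧
      (∀ i j, j ≠ i → ∀ c c', W c i j → W c' i j → lam i c j = lam i c' j →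
        lam j c i = lam j c' i → c = c') := by
  classical
  haveI : NeZero M := ⟨by rintro rfl; simp at hM⟩
  let W : (ZMod M × Fin g) → Fin (M + 1) → Fin (M + 1) → Prop :=
    fun c i j => (factorIdx M i j - c.1).val < g
  have hsym : ∀ c i j, W c i j → W c j i := by
    intro c i j h
    simp only [W] at h ⊢
    rwa [factorIdx_symm]
  have hsurj : ∀ i x, ∃ j, j ≠ i ∧ factorIdx M i j = x := by
    intro i x
    have himg : (Finset.univ.erase i).image (factorIdx M i) = Finset.univ := by
      apply Finset.eq_univ_of_card
      rw [Finset.card_image_of_injOn, Finset.card_erase_of_mem (Finset.mem_univ _)]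
      · simp
      · intro j hj j' hj' h
        simp at hj hj'
        exact factorIdx_inj M hM i j j' hj hj' h
    have := Finset.mem_univ x
    rw [← himg, Finset.mem_image] at this
    obtain ⟨j, hj, h⟩ := this
    exact ⟨j, (Finset.mem_erase.1 hj).1, h⟩
  have hdeg : ∀ c i, (Finset.univ.filter (fun j => j ≠ i ∧ W c i j)).card = g := by
    intro c i
    refine Eq.trans ?_ (card_window M g hg)
    refine Finset.card_bij (fun j _ => factorIdx M i j - c.1) ?_ ?_ ?_
    · intro j hj
      simp only [Finset.mem_filter, Finset.mem_univ, true_and] at hj ⊢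
      exact hj.2
    · intro j hj j' hj' h
      simp only [Finset.mem_filter, Finset.mem_univ, true_and] at hj hj'
      exact factorIdx_inj M hM i j j' hj.1 hj'.1 (sub_left_injective h)
    · intro x hx
      obtain ⟨j, hj, h⟩ := hsurj i (x + c.1)
      refine ⟨j, ?_, by rw [h]; ring⟩
      simp only [Finset.mem_filter, Finset.mem_univ, true_and] at hx ⊢
      refine ⟨hj, ?_⟩
      simp only [W]
      rw [h, add_sub_cancel_right]; exact hx
  obtain ⟨lam, H1, H2, H3⟩ := detachment g W hdeg hsym (fun _ c _ => c.2) (by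
    intro i j _ a
    refine Eq.trans ?_ (card_window M g hg)
    refine Finset.card_bij (fun c _ => factorIdx M i j - c.1) ?_ ?_ ?_
    · intro c hc
      simp only [Finset.mem_filter, Finset.mem_univ, true_and] at hc ⊢
      exact hc.1
    · rintro ⟨s, r⟩ hc ⟨s', r'⟩ hc' h
      simp only [Finset.mem_filter, Finset.mem_univ, true_and] at hc hc'
      obtain ⟨-, rfl⟩ := hc
      obtain ⟨-, rfl⟩ := hc'
      have : s = s' := sub_right_injective h
      rw [this]
    · intro x hx
      refine ⟨(factorIdx M i j - x, a), ?_, by simp⟩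
      simp only [Finset.mem_filter, Finset.mem_univ, true_and] at hx ⊢
      refine ⟨?_, trivial⟩
      simp only [W]
      rwa [sub_sub_cancel]) Finset.univ
  have H3' : ∀ i j, j ≠ i → ∀ c c', W c i j → W c' i j → lam i c j = lam i c' j →
        lam j c i = lam j c' i → c = c' :=
    fun i j => H3 i (Finset.mem_univ _) j (Finset.mem_univ _)
  refine ⟨W, lam, hsym, ?_, fun i => H2 i (Finset.mem_univ _), ?_, H3'⟩
  · intro i c a
    have himg : (Finset.univ.filter (fun j => j ≠ i ∧ W c i j)).image (lam i c) = Finset.univ := by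
      apply Finset.eq_univ_of_card
      rw [Finset.card_image_of_injOn, hdeg]
      · simp
      · intro j hj j' hj' h
        simp at hj hj'
        exact H2 i (Finset.mem_univ _) c j j' hj.1 hj'.1 hj.2 hj'.2 h
    have := Finset.mem_univ a
    rw [← himg, Finset.mem_image] at this
    obtain ⟨j, hj, h⟩ := this
    simp only [Finset.mem_filter, Finset.mem_univ, true_and] at hj
    exact ⟨j, hj.1, hj.2, h⟩
  · intro i j hj a b
    have himg : (Finset.univ.filter (fun c => W c i j ∧ lam i c j = a)).image
        (fun c => lam j c i) = Finset.univ := by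
      apply Finset.eq_univ_of_card
      rw [Finset.card_image_of_injOn, H1 i j hj]
      · simp
      · intro c hc c' hc' h
        simp at hc hc'
        exact H3' i j hj c c' hc.1 hc'.1 (hc.2.trans hc'.2.symm) h
    have := Finset.mem_univ b
    rw [← himg, Finset.mem_image] at this
    obtain ⟨c, hc, h⟩ := this
    simp only [Finset.mem_filter, Finset.mem_univ, true_and] at hc
    exact ⟨c, hc.1, hc.2, h⟩

lemma weight_two_support {m q : ℕ} (x : Fin m → Fin q) (h : wordWeight x = 2) :
    ∃ i j, j ≠ i ∧ ∀ k, (x k : ℕ) ≠ 0 ↔ (k = i ∨ k = j) := by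
  unfold wordWeight at h
  obtain ⟨i, j, hij, hs⟩ := Finset.card_eq_two.1 h
  refine ⟨i, j, hij.symm, fun k => ?_⟩
  have := Finset.ext_iff.1 hs k
  simpa using this

lemma weight_two_of_support {m q : ℕ} (x : Fin m → Fin q) (i j : Fin m) (hj : j ≠ i)
    (h : ∀ k, (x k : ℕ) ≠ 0 ↔ (k = i ∨ k = j)) : wordWeight x = 2 := by
  unfold wordWeight
  rw [Finset.card_eq_two]
  refine ⟨i, j, hj.symm, ?_⟩
  ext k
  simpa using h k

theorem exists_OF_general (M g : ℕ) (hM : Odd M) (hg : g ≤ M) :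
    HasDist3Partition (M + 1) g (g * M) (g * (M + 1) / 2) := by
  classical
  haveI : NeZero M := ⟨by rintro rfl; simp at hM⟩
  obtain ⟨W, lam, hsym, hA, hA', hB, hB'⟩ := exists_labels M g hM hg
  let Q : (ZMod M × Fin g) → Finset (Fin (M + 1) → Fin (g + 1)) := fun c =>
    (weightTwoWords (M + 1) g).filter (fun x => ∀ i j, j ≠ i → (x i : ℕ) ≠ 0 → (x j : ℕ) ≠ 0 →
      W c i j ∧ (x i : ℕ) = (lam i c j : ℕ) + 1)
  have hQ : ∀ c x, x ∈ Q c ↔ wordWeight x = 2 ∧ ∀ i j, j ≠ i → (x i : ℕ) ≠ 0 → (x j : ℕ) ≠ 0 →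
      W c i j ∧ (x i : ℕ) = (lam i c j : ℕ) + 1 := by
    intro c x; simp [Q, weightTwoWords]
  -- agreement in a nonzero coordinate
  have hagree : ∀ c, ∀ x ∈ Q c, ∀ y ∈ Q c, ∀ i, (x i : ℕ) ≠ 0 → x i = y i → x = y := by
    intro c x hx y hy i hi hxy
    rw [hQ] at hx hy
    obtain ⟨hx1, hx2⟩ := hx
    obtain ⟨hy1, hy2⟩ := hy
    have key : ∀ z : Fin (M + 1) → Fin (g + 1), wordWeight z = 2 → (z i : ℕ) ≠ 0 →
        ∃ j, j ≠ i ∧ ∀ k, (z k : ℕ) ≠ 0 ↔ (k = i ∨ k = j) := by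
      intro z hz hzi
      obtain ⟨i1, j1, hne, hs⟩ := weight_two_support z hz
      rcases (hs i).1 hzi with rfl | rfl
      · exact ⟨j1, hne, hs⟩
      · exact ⟨i1, hne.symm, fun k => (hs k).trans or_comm⟩
    obtain ⟨j, hj, hsx⟩ := key x hx1 hi
    obtain ⟨j', hj', hsy⟩ := key y hy1 (hxy ▸ hi)
    have e1 := hx2 i j hj hi ((hsx j).2 (Or.inr rfl))
    have e2 := hy2 i j' hj' (hxy ▸ hi) ((hsy j').2 (Or.inr rfl))
    have e3 : lam i c j = lam i c j' := by
      apply Fin.ext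
      have := congrArg Fin.val hxy
      omega
    have ejj := hA' i c j j' hj hj' e1.1 e2.1 e3
    subst ejj
    have f1 := hx2 j i hj.symm ((hsx j).2 (Or.inr rfl)) hi
    have f2 := hy2 j i hj.symm ((hsy j).2 (Or.inr rfl)) (hxy ▸ hi)
    funext k
    by_cases hk : k = i ∨ k = j
    · rcases hk with rfl | rfl
      · exact hxy
      · apply Fin.ext; omega
    · have h1 := not_congr (hsx k) |>.2 hk
      have h2 := not_congr (hsy k) |>.2 hk
      apply Fin.ext; omega
  have hdist : ∀ c, ∀ x ∈ Q c, ∀ y ∈ Q c, x ≠ y → 3 ≤ hammingDist x y := by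
    intro c x hx y hy hne
    have hx' := (hQ c x).1 hx
    have hy' := (hQ c y).1 hy
    let sx := Finset.univ.filter (fun i => (x i : ℕ) ≠ 0)
    let sy := Finset.univ.filter (fun i => (y i : ℕ) ≠ 0)
    have cx : sx.card = 2 := hx'.1
    have cy : sy.card = 2 := hy'.1
    have hsne : sx ≠ sy := by
      intro h
      obtain ⟨i, j, hij, hs⟩ := weight_two_support x hx'.1
      have hyi : ∀ k, (x k : ℕ) ≠ 0 → (y k : ℕ) ≠ 0 := by
        intro k hk
        have : k ∈ sx := by simpa [sx] using hk
        rw [h] at this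
        simpa [sy] using this
      have xi := (hs i).2 (Or.inl rfl)
      have xj := (hs j).2 (Or.inr rfl)
      have e1 := (hx'.2 i j hij xi xj).2
      have e2 := (hy'.2 i j hij (hyi i xi) (hyi j xj)).2
      exact hne (hagree c x hx y hy i xi (Fin.ext (by omega)))
    have hsub : sx ∪ sy ⊆ Finset.univ.filter (fun i => x i ≠ y i) := by
      intro i hi
      simp only [Finset.mem_filter, Finset.mem_univ, true_and]
      intro h
      rcases Finset.mem_union.1 hi with hi | hi
      · exact hne (hagree c x hx y hy i (by simpa [sx] using hi) h)
      · exact hne (hagree c y hy x hx i (by simpa [sy] using hi) h.symm).symm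
    have hlt : 2 < (sx ∪ sy).card := by
      rw [← cx]
      apply Finset.card_lt_card
      refine Finset.ssubset_iff_subset_ne.2 ⟨Finset.subset_union_left, fun h => hsne ?_⟩
      have : sy ⊆ sx := by rw [h]; exact Finset.subset_union_right
      exact (Finset.eq_of_subset_of_card_le this (by omega)).symm
    have := Finset.card_le_card hsub
    unfold hammingDist
    omega
  have hdisj : ∀ c c' x, x ∈ Q c → x ∈ Q c' → c = c' := by
    intro c c' x hx hx'
    rw [hQ] at hx hx'
    obtain ⟨i, j, hij, hs⟩ := weight_two_support x hx.1
    have xi := (hs i).2 (Or.inl rfl)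
    have xj := (hs j).2 (Or.inr rfl)
    have a1 := hx.2 i j hij xi xj
    have a2 := hx.2 j i hij.symm xj xi
    have b1 := hx'.2 i j hij xi xj
    have b2 := hx'.2 j i hij.symm xj xi
    exact hB' i j hij c c' a1.1 b1.1 (Fin.ext (by omega)) (Fin.ext (by omega))
  have hmk : ∀ c i j (x : Fin (M + 1) → Fin (g + 1)), j ≠ i →
      (∀ k, (x k : ℕ) ≠ 0 ↔ (k = i ∨ k = j)) →
      W c i j → (x i : ℕ) = (lam i c j : ℕ) + 1 → (x j : ℕ) = (lam j c i : ℕ) + 1 → x ∈ Q c := by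
    intro c i j x hij hs hw h1 h2
    rw [hQ]
    refine ⟨weight_two_of_support x i j hij hs, ?_⟩
    intro k l hkl hk hl
    rcases (hs k).1 hk with rfl | rfl <;> rcases (hs l).1 hl with rfl | rfl
    · exact absurd rfl hkl
    · exact ⟨hw, h1⟩
    · exact ⟨hsym _ _ _ hw, h2⟩
    · exact absurd rfl hkl
  have hcov : ∀ x, wordWeight x = 2 → ∃ c, x ∈ Q c := by
    intro x hx
    obtain ⟨i, j, hij, hs⟩ := weight_two_support x hx
    have xi := (hs i).2 (Or.inl rfl)
    have xj := (hs j).2 (Or.inr rfl)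
    have li := (x i).2
    have lj := (x j).2
    obtain ⟨c, hw, h1, h2⟩ := hB i j hij ⟨(x i : ℕ) - 1, by omega⟩ ⟨(x j : ℕ) - 1, by omega⟩
    refine ⟨c, hmk c i j x hij hs hw ?_ ?_⟩
    · rw [h1]; simp only; omega
    · rw [h2]; simp only; omega
  have hcard : ∀ c, (Q c).card = g * (M + 1) / 2 := by
    intro c
    have hvert : ∀ i, ((Q c).filter (fun x => (x i : ℕ) ≠ 0)).card = g := by
      intro i
      refine Eq.trans ?_ (Finset.card_fin g)
      refine Finset.card_bij (fun x hx => (⟨(x i : ℕ) - 1, by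
        have := (x i).2
        have := (Finset.mem_filter.1 hx).2
        omega⟩ : Fin g)) ?_ ?_ ?_
      · intro x hx; simp
      · intro x hx y hy h
        obtain ⟨hx1, hx2⟩ := Finset.mem_filter.1 hx
        obtain ⟨hy1, hy2⟩ := Finset.mem_filter.1 hy
        simp only [Fin.mk.injEq] at h
        exact hagree c x hx1 y hy1 i hx2 (Fin.ext (by omega))
      · intro a _
        obtain ⟨j, hj, hw, hl⟩ := hA i c a
        let x : Fin (M + 1) → Fin (g + 1) := fun k =>
          if k = i then a.succ else if k = j then (lam j c i).succ else 0
        have xi : x i = a.succ := by simp [x]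
        have xj : x j = (lam j c i).succ := by simp [x, hj]
        have hs : ∀ k, (x k : ℕ) ≠ 0 ↔ (k = i ∨ k = j) := by
          intro k
          by_cases h1 : k = i
          · simp [x, h1]
          · by_cases h2 : k = j
            · simp [x, h2, hj]
            · simp [x, h1, h2]
        refine ⟨x, Finset.mem_filter.2 ⟨hmk c i j x hj hs hw ?_ ?_, ?_⟩, ?_⟩
        · rw [xi, hl]; simp
        · rw [xj]; simp
        · rw [xi]; simp
        · apply Fin.ext; simp [xi]
    have h1 : ∑ x ∈ Q c, ∑ i : Fin (M + 1), (if (x i : ℕ) ≠ 0 then 1 else 0) = 2 * (Q c).card := by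
      rw [Finset.sum_congr rfl (g := fun _ => 2)]
      · simp [mul_comm]
      · intro x hx
        rw [← Finset.card_filter]
        exact ((hQ c x).1 hx).1
    rw [Finset.sum_comm] at h1
    rw [Finset.sum_congr rfl (g := fun _ => g)] at h1
    · simp at h1
      rw [mul_comm g, h1]; simp
    · intro i _
      rw [← Finset.card_filter]
      exact hvert i
  have hK : Fintype.card (Fin (g * M)) = Fintype.card (ZMod M × Fin g) := by
    simp [ZMod.card, mul_comm]
  let e : Fin (g * M) ≃ (ZMod M × Fin g) := Fintype.equivOfCardEq hK
  refine ⟨fun k => Q (e k), ?_, ?_, fun k => hcard _, fun k => hdist _⟩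
  · intro k l hkl
    rw [Finset.disjoint_left]
    intro x hx hx'
    exact hkl (e.injective (hdisj _ _ x hx hx'))
  · ext x
    simp only [Finset.mem_biUnion, Finset.mem_univ, true_and]
    constructor
    · rintro ⟨k, hk⟩
      exact (Finset.mem_filter.1 hk).1
    · intro hx
      obtain ⟨c, hc⟩ := hcov x (by simpa [weightTwoWords] using hx)
      exact ⟨e.symm c, by simpa using hc⟩

/-- For every odd `g ≥ 3` and every odd `n ≥ g`, an `OF(2n,g)` exists. -/
theorem exists_OF_two_n_odd_odd (n g : ℕ) (hg3 : 3 ≤ g) (hgo : Odd g) (hno : Odd n)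
    (hgn : g ≤ n) : IsOF (2 * n) g := by
  obtain ⟨M, hM⟩ : ∃ M, 2 * n = M + 1 := ⟨2 * n - 1, by omega⟩
  unfold IsOF
  rw [hM]
  exact exists_OF_general M g ⟨n - 1, by omega⟩ (by omega)
end

section
/- For every even integer g ≥ 2 and every even integer n with n ≥ 2g, there exists an OF(2n, g). -/
namespace OFProof

/-- The word with letter `v.2` at `v.1` and `w.2` at `w.1`. -/
def mkWord {m g : ℕ} (v w : Fin m × Fin g) : Fin m → Fin (g + 1) :=
  fun i => if i = v.1 then v.2.succ else if i = w.1 then w.2.succ else 0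

theorem mkWord_mem {m g : ℕ} {v w : Fin m × Fin g} (h : v.1 ≠ w.1) (u : Fin m × Fin g) :
    mkWord v w u.1 = u.2.succ ↔ u = v ∨ u = w := by
  obtain ⟨v1, v2⟩ := v
  obtain ⟨w1, w2⟩ := w
  obtain ⟨u1, u2⟩ := u
  simp only [mkWord, Prod.mk.injEq] at *
  split_ifs with h1 h2
  · subst h1
    simp [h, eq_comm]
  · subst h2
    simp [h1, eq_comm]
  · simp [h1, h2, eq_comm, Fin.succ_ne_zero]

theorem mkWord_inj {m g : ℕ} {v w v' w' : Fin m × Fin g} (h : v.1 ≠ w.1) (h' : v'.1 ≠ w'.1)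
    (e : mkWord v w = mkWord v' w') : (v = v' ∧ w = w') ∨ (v = w' ∧ w = v') := by
  have h1 := (mkWord_mem h v).2 (Or.inl rfl)
  have h2 := (mkWord_mem h w).2 (Or.inr rfl)
  rw [e, mkWord_mem h'] at h1 h2
  have hvw : v ≠ w := fun h3 => h (by rw [h3])
  rcases h1 with h1 | h1 <;> rcases h2 with h2 | h2
  · exact absurd (h1.trans h2.symm) hvw
  · exact Or.inl ⟨h1, h2⟩
  · exact Or.inr ⟨h1, h2⟩
  · exact absurd (h1.trans h2.symm) hvw

theorem mkWord_comm {m g : ℕ} {v w : Fin m × Fin g} (h : v.1 ≠ w.1) :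
    mkWord v w = mkWord w v := by
  funext i
  simp only [mkWord]
  split_ifs with h1 h2 <;> simp_all

theorem mkWord_ne_zero {m g : ℕ} {v w : Fin m × Fin g} (i : Fin m) :
    (mkWord v w i : ℕ) ≠ 0 ↔ i = v.1 ∨ i = w.1 := by
  simp only [mkWord]
  split_ifs with h1 h2 <;> simp_all

theorem mkWord_weight {m g : ℕ} {v w : Fin m × Fin g} (h : v.1 ≠ w.1) :
    mkWord v w ∈ weightTwoWords m g := by
  have : (Finset.univ.filter (fun i => (mkWord v w i : ℕ) ≠ 0)) = {v.1, w.1} := by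
    ext i
    simp only [Finset.mem_filter, Finset.mem_univ, true_and, mkWord_ne_zero,
      Finset.mem_insert, Finset.mem_singleton]
  rw [weightTwoWords, Finset.mem_filter]
  refine ⟨Finset.mem_univ _, ?_⟩
  rw [wordWeight, this, Finset.card_pair h]

theorem exists_mkWord {m g : ℕ} {x : Fin m → Fin (g + 1)} (hx : x ∈ weightTwoWords m g) :
    ∃ v w : Fin m × Fin g, v.1 ≠ w.1 ∧ mkWord v w = x := by
  rw [weightTwoWords, Finset.mem_filter] at hx
  replace hx := hx.2
  rw [wordWeight] at hx
  obtain ⟨p, r, hpr, hs⟩ := Finset.card_eq_two.1 hx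
  have hm : ∀ i, (x i : ℕ) ≠ 0 ↔ i = p ∨ i = r := by
    intro i
    have : i ∈ (Finset.univ.filter (fun i => (x i : ℕ) ≠ 0)) ↔
        i ∈ ({p, r} : Finset (Fin m)) := by rw [hs]
    simpa using this
  have hp : x p ≠ 0 := by
    have := (hm p).2 (Or.inl rfl)
    intro h
    simp [h] at this
  have hr : x r ≠ 0 := by
    have := (hm r).2 (Or.inr rfl)
    intro h
    simp [h] at this
  refine ⟨(p, (x p).pred hp), (r, (x r).pred hr), hpr, ?_⟩
  funext i
  simp only [mkWord, Fin.succ_pred]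
  split_ifs with h1 h2
  · rw [h1]
  · rw [h2]
  · have := mt (hm i).1 (by tauto)
    ext
    simp only [ne_eq, not_not] at this
    simp [this]

theorem three_le_dist {m g : ℕ} {x y : Fin m → Fin (g + 1)} {i j k : Fin m}
    (hij : i ≠ j) (hik : i ≠ k) (hjk : j ≠ k) (hi : x i ≠ y i) (hj : x j ≠ y j)
    (hk : x k ≠ y k) : 3 ≤ hammingDist x y := by
  have h3 : ({i, j, k} : Finset (Fin m)).card = 3 := Finset.card_eq_three.2
    ⟨i, j, k, hij, hik, hjk, rfl⟩
  rw [← h3, hammingDist]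
  apply Finset.card_le_card
  intro a ha
  simp only [Finset.mem_insert, Finset.mem_singleton] at ha
  simp only [Finset.mem_filter, Finset.mem_univ, true_and]
  rcases ha with rfl | rfl | rfl <;> assumption

theorem isOF_of_fin {m g : ℕ} (hm : 1 ≤ m)
    (N : Fin (g * (m - 1)) → Fin m × Fin g → Fin m × Fin g)
    (hinv : ∀ k v, N k (N k v) = v)
    (hne : ∀ k v, v.1 ≠ (N k v).1)
    (hpar : ∀ k v w, v.1 = w.1 → (N k v).1 = (N k w).1 → v = w)
    (hcov : ∀ v w : Fin m × Fin g, v.1 ≠ w.1 → ∃ k, N k v = w) : IsOF m g := by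
  classical
  -- injectivity of colours
  have hinj : ∀ v, Function.Injective (fun k => N k v) := by
    intro v
    have hsurj : Function.Surjective
        (fun k => (⟨N k v, (hne k v).symm⟩ : {w : Fin m × Fin g // w.1 ≠ v.1})) := by
      rintro ⟨w, hw⟩
      obtain ⟨k, hk⟩ := hcov v w hw.symm
      exact ⟨k, Subtype.ext hk⟩
    have hcard : Fintype.card (Fin (g * (m - 1))) =
        Fintype.card {w : Fin m × Fin g // w.1 ≠ v.1} := by
      rw [Fintype.card_subtype]
      have : (Finset.univ.filter (fun w : Fin m × Fin g => w.1 ≠ v.1)) =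
          (Finset.univ.erase v.1) ×ˢ (Finset.univ : Finset (Fin g)) := by
        ext w
        simp
      rw [this, Finset.card_product, Finset.card_erase_of_mem (Finset.mem_univ _)]
      simp [mul_comm]
    have hb := (Fintype.bijective_iff_surjective_and_card _).2 ⟨hsurj, hcard⟩
    intro k k' hk
    exact hb.1 (Subtype.ext hk)
  refine ⟨fun k => Finset.univ.image (fun v => mkWord v (N k v)), ?_, ?_, ?_, ?_⟩
  · intro k k' hkk
    rw [Finset.disjoint_left]
    intro x hx hx'
    simp only [Finset.mem_image, Finset.mem_univ, true_and] at hx hx'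
    obtain ⟨v, rfl⟩ := hx
    obtain ⟨v', hv'⟩ := hx'
    apply hkk
    rcases mkWord_inj (hne k' v') (hne k v) hv' with ⟨h1, h2⟩ | ⟨h1, h2⟩
    · subst h1
      exact (hinj _ h2).symm
    · apply hinj v
      have := congrArg (N k') h2
      rw [hinv] at this
      simp only
      rw [← this, h1]
  · ext x
    simp only [Finset.mem_biUnion, Finset.mem_image, Finset.mem_univ, true_and]
    constructor
    · rintro ⟨k, v, rfl⟩
      exact mkWord_weight (hne k v)
    · intro hx
      obtain ⟨v, w, hvw, rfl⟩ := exists_mkWord hx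
      obtain ⟨k, rfl⟩ := hcov v w hvw
      exact ⟨k, v, rfl⟩
  · intro k
    have h := Finset.card_eq_sum_card_image (fun v => mkWord v (N k v))
      (Finset.univ : Finset (Fin m × Fin g))
    have h2 : ∀ x ∈ Finset.univ.image (fun v => mkWord v (N k v)),
        (Finset.univ.filter (fun v => mkWord v (N k v) = x)).card = 2 := by
      intro x hx
      simp only [Finset.mem_image, Finset.mem_univ, true_and] at hx
      obtain ⟨v, rfl⟩ := hx
      have hvn : v ≠ N k v := fun h3 => hne k v (congrArg Prod.fst h3)
      rw [← Finset.card_pair hvn]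
      congr 1
      ext u
      simp only [Finset.mem_filter, Finset.mem_univ, true_and, Finset.mem_insert,
        Finset.mem_singleton]
      constructor
      · intro hu
        rcases mkWord_inj (hne k u) (hne k v) hu with h | h
        · exact Or.inl h.1
        · exact Or.inr h.1
      · rintro (rfl | rfl)
        · rfl
        · rw [hinv]
          exact (mkWord_comm (hne k v)).symm
    rw [Finset.sum_congr rfl h2] at h
    simp only [Finset.card_univ, Fintype.card_prod, Fintype.card_fin, Finset.sum_const,
      smul_eq_mul] at h
    rw [mul_comm g m, h]
    simp
  · intro k x hx y hy hxy
    simp only [Finset.mem_image, Finset.mem_univ, true_and] at hx hy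
    obtain ⟨v, rfl⟩ := hx
    obtain ⟨v', rfl⟩ := hy
    have h1 : v ≠ v' := fun h => hxy (by rw [h])
    have h2 : v ≠ N k v' := by
      rintro rfl
      apply hxy
      rw [hinv]
      exact (mkWord_comm (hne k v')).symm
    have h3 : N k v ≠ v' := by
      rintro rfl
      exact h2 (hinv _ _).symm
    have h4 : N k v ≠ N k v' := fun h => h1 (by rw [← hinv k v, h, hinv])
    have d1 : ∀ u, (u = v ∨ u = N k v) →
        mkWord v (N k v) u.1 ≠ mkWord v' (N k v') u.1 := by
      intro u hu he
      rw [(mkWord_mem (hne k v) u).2 hu, eq_comm, mkWord_mem (hne k v')] at he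
      rcases hu with rfl | rfl <;> tauto
    have d2 : ∀ u, (u = v' ∨ u = N k v') →
        mkWord v (N k v) u.1 ≠ mkWord v' (N k v') u.1 := by
      intro u hu he
      rw [(mkWord_mem (hne k v') u).2 hu, mkWord_mem (hne k v)] at he
      rcases hu with rfl | rfl <;> rcases he with h | h <;> simp_all
    by_cases a : v'.1 = v.1 ∨ v'.1 = (N k v).1
    · by_cases b : (N k v').1 = v.1 ∨ (N k v').1 = (N k v).1
      · exfalso
        have hn := hne k v'
        rcases a with a | a <;> rcases b with b | b
        · exact hn (a.trans b.symm)
        · exact h1 (hpar k v v' a.symm b.symm)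
        · exact h2 (hpar k v _ b.symm (by rw [hinv, a]))
        · exact hn (a.trans b.symm)
      · push Not at b
        exact three_le_dist (hne k v) b.1.symm b.2.symm (d1 _ (Or.inl rfl)) (d1 _ (Or.inr rfl))
          (d2 _ (Or.inr rfl))
    · push Not at a
      exact three_le_dist (hne k v) a.1.symm a.2.symm (d1 _ (Or.inl rfl)) (d1 _ (Or.inr rfl))
          (d2 _ (Or.inl rfl))

theorem isOF_of {m g : ℕ} (hm : 1 ≤ m) {X L K : Type} [Fintype X] [Fintype L] [Fintype K]
    (hX : Fintype.card X = m) (hL : Fintype.card L = g) (hK : Fintype.card K = g * (m - 1))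
    (N : K → X × L → X × L)
    (hinv : ∀ k v, N k (N k v) = v)
    (hne : ∀ k v, v.1 ≠ (N k v).1)
    (hpar : ∀ k x a b, (N k (x, a)).1 = (N k (x, b)).1 → a = b)
    (hcov : ∀ v w : X × L, v.1 ≠ w.1 → ∃ k, N k v = w) : IsOF m g := by
  let eX := Fintype.equivFinOfCardEq hX
  let eL := Fintype.equivFinOfCardEq hL
  let eK := Fintype.equivFinOfCardEq hK
  let e := Equiv.prodCongr eX eL
  refine isOF_of_fin hm (fun k v => e (N (eK.symm k) (e.symm v))) ?_ ?_ ?_ ?_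
  · intro k v
    simp [hinv]
  · intro k v h
    apply hne (eK.symm k) (e.symm v)
    apply eX.injective
    simpa [e] using h
  · rintro k ⟨v1, v2⟩ ⟨w1, w2⟩ h h'
    simp only at h
    subst h
    have := hpar (eK.symm k) (eX.symm v1) (eL.symm v2) (eL.symm w2) (by simpa [e] using h')
    rw [eL.symm.injective this]
  · intro v w h
    obtain ⟨k, hk⟩ := hcov (e.symm v) (e.symm w) (by simpa [e] using h)
    exact ⟨eK k, by simp [hk]⟩

end OFProof

namespace OFProof

theorem zmod_eq_of_int {n : ℕ} {a b : ℤ} (h : (a : ZMod n) = (b : ZMod n))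
    (h1 : a - b < n) (h2 : b - a < n) : a = b := by
  have h3 : (n : ℤ) ∣ b - a := (ZMod.intCast_eq_intCast_iff_dvd_sub a b n).1 h
  have := Int.eq_zero_of_abs_lt_dvd h3 (by rw [abs_lt]; constructor <;> linarith)
  linarith

/-- Near one-factors of the complete graph on `Option (ZMod (2q+1))`. -/
def psi0 (q : ℕ) (t : ZMod (2 * q + 1)) (u : Fin (q + 1) × Bool) : Option (ZMod (2 * q + 1)) :=
  if u.1 = 0 then (if u.2 then some t else none)
  else some (t + (if u.2 then -((u.1 : ℕ) : ℤ) else ((u.1 : ℕ) : ℤ) : ℤ))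

theorem psi0_injective (q : ℕ) (t : ZMod (2 * q + 1)) : Function.Injective (psi0 q t) := by
  have key : ∀ a b : ℤ, -q ≤ a → a ≤ q → -q ≤ b → b ≤ q →
      (t + (a : ZMod (2 * q + 1)) = t + (b : ZMod (2 * q + 1))) → a = b := by
    intro a b h1 h2 h3 h4 h
    apply zmod_eq_of_int (add_left_cancel h) <;> push_cast <;> linarith
  have key0 : ∀ a : ℤ, -q ≤ a → a ≤ q → (t = t + (a : ZMod (2 * q + 1))) → 0 = a := by
    intro a h1 h2 h
    exact key 0 a (by omega) (by omega) h1 h2 (by simpa using h)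
  rintro ⟨⟨i, hi⟩, β⟩ ⟨⟨j, hj⟩, γ⟩ h
  simp only [psi0, Fin.mk_eq_zero] at h
  have main : i = j ∧ β = γ := by
    by_cases h1 : i = 0 <;> by_cases h2 : j = 0 <;> cases β <;> cases γ <;>
      simp only [h1, h2, if_true, if_false, Option.some.injEq, reduceCtorEq, Bool.false_eq_true]
        at h ⊢
    all_goals first
      | tauto
      | (have := key _ _ (by omega) (by omega) (by omega) (by omega) h; simp; omega)
      | (have := key0 _ (by omega) (by omega) h; simp; omega)
      | (have := key0 _ (by omega) (by omega) h.symm; simp; omega)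
  obtain ⟨rfl, rfl⟩ := main
  rfl

theorem psi0_bijective (q : ℕ) (t : ZMod (2 * q + 1)) : Function.Bijective (psi0 q t) := by
  rw [Fintype.bijective_iff_injective_and_card]
  refine ⟨psi0_injective q t, ?_⟩
  simp [ZMod.card]
  ring

theorem psi0_cover (q : ℕ) (a b : Option (ZMod (2 * q + 1))) (hab : a ≠ b) :
    ∃ t i β, psi0 q t (i, β) = a ∧ psi0 q t (i, !β) = b := by
  rcases a with _ | a <;> rcases b with _ | b
  · exact absurd rfl hab
  · exact ⟨b, 0, false, by simp [psi0], by simp [psi0]⟩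
  · exact ⟨a, 0, true, by simp [psi0], by simp [psi0]⟩
  · have hab' : a ≠ b := fun h => hab (by rw [h])
    have htwo : (2 : ZMod (2 * q + 1)) * (q + 1) = 1 := by
      have : ((2 * q + 1 : ℕ) : ZMod (2 * q + 1)) = 0 := ZMod.natCast_self _
      push_cast at this
      linear_combination this
    obtain ⟨t, ht⟩ : ∃ t : ZMod (2 * q + 1), 2 * t = a + b :=
      ⟨(q + 1) * (a + b), by rw [← mul_assoc, htwo, one_mul]⟩
    obtain ⟨d, hd⟩ : ∃ d : ZMod (2 * q + 1), d = a - t := ⟨_, rfl⟩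
    have ha : a = t + d := by rw [hd]; ring
    have hb : b = t - d := by rw [hd]; linear_combination -ht
    have hd0 : d ≠ 0 := by
      rintro rfl
      apply hab'
      rw [ha, hb]
      ring
    have hlt := ZMod.val_lt d
    have hpos : d.val ≠ 0 := by rwa [Ne, ZMod.val_eq_zero]
    have hcast : ((d.val : ℕ) : ZMod (2 * q + 1)) = d := ZMod.natCast_zmod_val d
    by_cases hle : d.val ≤ q
    · refine ⟨t, ⟨d.val, by omega⟩, false, ?_, ?_⟩
      · simp [psi0, Fin.mk_eq_zero, hpos, hcast, ha, hd0]
      · simp [psi0, Fin.mk_eq_zero, hpos, hcast, hb, hd0, sub_eq_add_neg]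
    · have hc2 : ((2 * q + 1 - d.val : ℕ) : ZMod (2 * q + 1)) = -d := by
        rw [Nat.cast_sub (by omega), hcast, ZMod.natCast_self, zero_sub]
      have hne : 2 * q + 1 - d.val ≠ 0 := by omega
      refine ⟨t, ⟨2 * q + 1 - d.val, by omega⟩, true, ?_, ?_⟩
      · simp only [psi0, Fin.mk_eq_zero, hne, if_false, if_true, Int.cast_neg, Int.cast_natCast,
          hc2, neg_neg, ha]
      · simp only [psi0, Fin.mk_eq_zero, hne, if_false, Bool.not_true, Bool.false_eq_true,
          Int.cast_natCast, hc2, hb, sub_eq_add_neg]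

theorem oneFac (q : ℕ) (L : Type) [Fintype L] (hL : Fintype.card L = 2 * q + 2) :
    ∃ ψ : ZMod (2 * q + 1) → (L ≃ Fin (q + 1) × Bool),
      ∀ a b, a ≠ b → ∃ t i β, a = (ψ t).symm (i, β) ∧ b = (ψ t).symm (i, !β) := by
  have hc : Fintype.card L = Fintype.card (Option (ZMod (2 * q + 1))) := by
    rw [hL, Fintype.card_option, ZMod.card]
  let e := Fintype.equivOfCardEq hc
  refine ⟨fun t => e.trans (Equiv.ofBijective _ (psi0_bijective q t)).symm, ?_⟩
  intro a b hab
  obtain ⟨t, i, β, h1, h2⟩ := psi0_cover q (e a) (e b) (by simpa using hab)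
  refine ⟨t, i, β, ?_, ?_⟩
  · simp [h1]
  · simp [h2]

/-- One-factorization of a complete graph, as a family of involutions. -/
theorem oneFacInv (q : ℕ) (X : Type) [Fintype X] (hX : Fintype.card X = 2 * q + 2) :
    ∃ F : ZMod (2 * q + 1) → X → X, (∀ k x, F k (F k x) = x) ∧ (∀ k x, x ≠ F k x) ∧
      (∀ x y, x ≠ y → ∃ k, F k x = y) ∧ (∀ k l x, F k x = F l x → k = l) := by
  classical
  obtain ⟨ψ, hψ⟩ := oneFac q X hX
  let F : ZMod (2 * q + 1) → X → X := fun k x => (ψ k).symm ((ψ k x).1, !(ψ k x).2)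
  have h2 : ∀ k x, x ≠ F k x := by
    intro k x h
    have h' := congrArg (fun z => (ψ k z).2) h
    simp [F] at h'
  have h3 : ∀ x y, x ≠ y → ∃ k, F k x = y := by
    intro x y hxy
    obtain ⟨t, i, β, rfl, rfl⟩ := hψ x y hxy
    exact ⟨t, by simp [F]⟩
  refine ⟨F, ?_, h2, h3, ?_⟩
  · intro k x
    simp [F]
  · intro k l x hkl
    have hs : Function.Surjective (fun k => (⟨F k x, (h2 k x).symm⟩ : {y : X // y ≠ x})) := by
      rintro ⟨y, hy⟩
      obtain ⟨k, hk⟩ := h3 x y hy.symm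
      exact ⟨k, Subtype.ext hk⟩
    have hcard : Fintype.card (ZMod (2 * q + 1)) = Fintype.card {y : X // y ≠ x} := by
      rw [ZMod.card, Fintype.card_subtype_compl, hX, Fintype.card_subtype_eq]
      omega
    have hb := (Fintype.bijective_iff_surjective_and_card _).2 ⟨hs, hcard⟩
    exact hb.1 (Subtype.ext hkl)

/-! The shift tables. -/

/-- Shifts used for the mixed inner edges. -/
def muZ (p j i : ℕ) : ℤ :=
  if (j + i) % (2 * p) < p then (((j + i) % (2 * p) : ℕ) : ℤ) + 1
  else (p : ℤ) - 1 - (((j + i) % (2 * p) : ℕ) : ℤ)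

/-- Signed shifts used for the mixed inner edges. -/
def mu (p : ℕ) (j i : ℕ) (β : Bool) : ZMod (2 * p + 2) :=
  ((if β then - muZ p j i else muZ p j i : ℤ) : ZMod (2 * p + 2))

theorem mu_not (p j i : ℕ) (β : Bool) : mu p j i (!β) = - mu p j i β := by
  cases β <;> simp [mu]

theorem muZ_bd (p j i : ℕ) (hp : 0 < p) :
    -p ≤ muZ p j i ∧ muZ p j i ≤ p ∧ muZ p j i ≠ 0 := by
  have := Nat.mod_lt (j + i) (show 0 < 2 * p by omega)
  unfold muZ
  split_ifs <;> omega

theorem mu_ne (p j i : ℕ) (β : Bool) (hp : 0 < p) : mu p j i β ≠ 0 := by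
  intro h
  obtain ⟨h1, h2, h3⟩ := muZ_bd p j i hp
  rw [mu, ← Int.cast_zero] at h
  cases β <;> simp only [if_true, if_false, Bool.false_eq_true] at h <;>
  · have := zmod_eq_of_int h (by push_cast; omega) (by push_cast; omega)
    omega

theorem mod_cases (a m : ℕ) (h : a < 2 * m) : (a % m = a ∧ a < m) ∨ (a % m = a - m ∧ m ≤ a) := by
  by_cases h1 : a < m
  · exact Or.inl ⟨Nat.mod_eq_of_lt h1, h1⟩
  · right
    refine ⟨?_, by omega⟩
    rw [Nat.mod_eq_sub_mod (by omega), Nat.mod_eq_of_lt (by omega)]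

theorem mu_inj (p j i i' : ℕ) (β β' : Bool) (hj : j < 2 * p) (hi : i < p) (hi' : i' < p)
    (h : mu p j i β = mu p j i' β') : i = i' ∧ β = β' := by
  have hp : 0 < p := by omega
  obtain ⟨h1, h2, h3⟩ := muZ_bd p j i hp
  obtain ⟨h1', h2', h3'⟩ := muZ_bd p j i' hp
  have h' := zmod_eq_of_int h (by push_cast; split_ifs <;> omega)
    (by push_cast; split_ifs <;> omega)
  have e1 := mod_cases (j + i) (2 * p) (by omega)
  have e2 := mod_cases (j + i') (2 * p) (by omega)
  unfold muZ at h'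
  cases β <;> cases β' <;> simp only [if_true, if_false, Bool.false_eq_true] at h' <;>
    simp <;> split_ifs at h' <;> omega

theorem mu_surj_aux (p i : ℕ) (hi : i < p) (z : ZMod (2 * p + 2)) (hz : z ≠ 0)
    (hz' : z ≠ ((p + 1 : ℕ) : ZMod (2 * p + 2))) : ∃ j < 2 * p, ((muZ p j i : ℤ) : ZMod (2 * p + 2)) = z := by
  have hlt := ZMod.val_lt z
  have hpos : z.val ≠ 0 := by rwa [Ne, ZMod.val_eq_zero]
  have hcast : ((z.val : ℕ) : ZMod (2 * p + 2)) = z := ZMod.natCast_zmod_val z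
  have hne : z.val ≠ p + 1 := by
    intro h
    rw [h] at hcast
    exact hz' hcast.symm
  have step : ∀ u < 2 * p, ∃ j < 2 * p, (j + i) % (2 * p) = u := by
    intro u hu
    by_cases hui : i ≤ u
    · exact ⟨u - i, by omega, by rw [Nat.mod_eq_of_lt] <;> omega⟩
    · refine ⟨u + 2 * p - i, by omega, ?_⟩
      rw [show u + 2 * p - i + i = u + 2 * p by omega, Nat.add_mod_right, Nat.mod_eq_of_lt hu]
  by_cases hle : z.val ≤ p
  · obtain ⟨j, hj, hj'⟩ := step (z.val - 1) (by omega)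
    refine ⟨j, hj, ?_⟩
    unfold muZ
    rw [hj', if_pos (by omega)]
    rw [show ((z.val - 1 : ℕ) : ℤ) + 1 = (z.val : ℤ) by omega]
    simp [hcast]
  · obtain ⟨j, hj, hj'⟩ := step (p + (2 * p + 2 - z.val) - 1) (by omega)
    refine ⟨j, hj, ?_⟩
    unfold muZ
    rw [hj', if_neg (by omega)]
    rw [show (p : ℤ) - 1 - ((p + (2 * p + 2 - z.val) - 1 : ℕ) : ℤ) =
      (z.val : ℤ) - ((2 * p + 2 : ℕ) : ℤ) by omega]
    rw [Int.cast_sub, Int.cast_natCast, Int.cast_natCast, hcast, ZMod.natCast_self, sub_zero]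

theorem half_add (p : ℕ) : ((p + 1 : ℕ) : ZMod (2 * p + 2)) + ((p + 1 : ℕ) : ZMod (2 * p + 2)) = 0 := by
  rw [← Nat.cast_add, show p + 1 + (p + 1) = 2 * p + 2 by ring, ZMod.natCast_self]

theorem mu_surj (p i : ℕ) (β : Bool) (hi : i < p) (z : ZMod (2 * p + 2)) (hz : z ≠ 0)
    (hz' : z ≠ ((p + 1 : ℕ) : ZMod (2 * p + 2))) : ∃ j < 2 * p, mu p j i β = z := by
  cases β
  · simpa [mu] using mu_surj_aux p i hi z hz hz'
  · obtain ⟨j, hj, h⟩ := mu_surj_aux p i hi (-z) (by simpa using hz) (by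
      intro h
      apply hz'
      have := half_add p
      linear_combination -h - this)
    exact ⟨j, hj, by simp [mu, h]⟩

/-- Shifts for the cross edges, as integers. -/
def epsZ (n r i : ℕ) (β : Bool) : ℕ :=
  if β then
    if r + 1 < 2 * i then r + 1 else if r + 1 = 2 * i then r + 2 else if r = 2 * i then r
    else if r = 2 * i + 1 then r - 1 else if i = 0 ∧ r = n then r + 1 else r
  else if r ≤ 2 * i then r else r - 1

/-- Shifts for the cross edges. -/
def eps (n r i : ℕ) (β : Bool) : ZMod n := ((4 * i + epsZ n r i β : ℕ) : ZMod n)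

theorem eps_spec0 (n i : ℕ) (β : Bool) : eps n (2 * i) i β = ((6 * i : ℕ) : ZMod n) := by
  unfold eps epsZ
  congr 1
  cases β <;> simp <;> omega

theorem eps_spec1 (n i : ℕ) (β : Bool) : eps n (2 * i + 1) i β = ((6 * i : ℕ) : ZMod n) := by
  unfold eps epsZ
  congr 1
  cases β <;> simp only [if_true, if_false, Bool.false_eq_true] <;> split_ifs <;> omega

theorem eps_inj (n q r i i' : ℕ) (β β' : Bool) (hn : 4 * q ≤ n) (hi : i < q) (hi' : i' < q)
    (h : eps n r i β = eps n r i' β') :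
    i = i' ∧ (β = β' ∨ r = 2 * i ∨ r = 2 * i + 1) := by
  have b : ∀ i β, (epsZ n r i β ≤ r + 2) ∧ (r ≤ epsZ n r i β + 1) := by
    intro i β
    unfold epsZ
    split_ifs <;> omega
  have b1 := b i β
  have b2 := b i' β'
  unfold eps at h
  rw [← Int.cast_natCast, ← Int.cast_natCast (4 * i' + _)] at h
  have h' := zmod_eq_of_int h (by push_cast; omega) (by push_cast; omega)
  have hii : i = i' := by omega
  subst hii
  refine ⟨rfl, ?_⟩
  have h'' : epsZ n r i β = epsZ n r i β' := by omega
  unfold epsZ at h''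
  cases β <;> cases β' <;> simp only [if_true, if_false, Bool.false_eq_true] at h'' <;>
    simp <;> split_ifs at h'' <;> omega

theorem eps_surj (n q i : ℕ) (β : Bool) (hn : 4 * q ≤ n) (hi : i < q) (z : ZMod n) :
    ∃ r ≤ n, eps n r i β = z := by
  have : NeZero n := ⟨by omega⟩
  obtain ⟨v, hv, hvz⟩ : ∃ v < n, (v : ZMod n) = z - ((4 * i : ℕ) : ZMod n) :=
    ⟨_, ZMod.val_lt _, ZMod.natCast_zmod_val _⟩
  have key : ∀ r, (epsZ n r i β = v ∨ epsZ n r i β = v + n) → eps n r i β = z := by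
    intro r hr
    unfold eps
    rcases hr with hr | hr <;> rw [hr] <;> push_cast [hvz] <;> simp
  cases β
  · by_cases h : v ≤ 2 * i
    · exact ⟨v, by omega, key v (by simp [epsZ]; omega)⟩
    · exact ⟨v + 1, by omega, key _ (by simp [epsZ]; omega)⟩
  · by_cases h1 : v = 2 * i
    · exact ⟨v, by omega, key _ (by simp only [epsZ, if_true, and_true]; split_ifs <;> omega)⟩
    by_cases h2 : v = 2 * i + 1
    · by_cases h3 : i = 0
      · exact ⟨n, by omega, key _ (by simp only [epsZ, if_true, and_true]; split_ifs <;> omega)⟩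
      · exact ⟨2 * i - 1, by omega, key _ (by simp only [epsZ, if_true, and_true]; split_ifs <;> omega)⟩
    by_cases h4 : v = 0
    · exact ⟨n, by omega, key _ (by simp only [epsZ, if_true, and_true]; split_ifs <;> omega)⟩
    by_cases h5 : v < 2 * i
    · exact ⟨v - 1, by omega, key _ (by simp only [epsZ, if_true, and_true]; split_ifs <;> omega)⟩
    · exact ⟨v, by omega, key _ (by simp only [epsZ, if_true, and_true]; split_ifs <;> omega)⟩

/-- Indicator of the lower half. -/
def tau (p : ℕ) (x : ZMod (2 * p + 2)) : Bool := decide (x.val < p + 1)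

theorem tau_half (p : ℕ) (x : ZMod (2 * p + 2)) :
    tau p (x + ((p + 1 : ℕ) : ZMod (2 * p + 2))) = !tau p x := by
  have h1 := ZMod.val_lt x
  have h2 : ((p + 1 : ℕ) : ZMod (2 * p + 2)).val = p + 1 := ZMod.val_natCast_of_lt (by omega)
  have h3 := mod_cases (x.val + (p + 1)) (2 * p + 2) (by omega)
  unfold tau
  rw [ZMod.val_add, h2]
  by_cases h : x.val < p + 1
  · simp [h]; omega
  · simp [h]; omega

end OFProof

namespace OFProof

/-- Neighbour map, pure inner edges. -/
def N1 {p : ℕ} {L : Type} (F : ZMod (2 * p + 1) → ZMod (2 * p + 2) → ZMod (2 * p + 2))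
    (c : L → ZMod (2 * p + 1)) (k : ZMod (2 * p + 1)) (v : (Bool × ZMod (2 * p + 2)) × L) :
    (Bool × ZMod (2 * p + 2)) × L :=
  ((v.1.1, F (k + c v.2) v.1.2), v.2)

/-- Neighbour map, mixed inner edges. -/
def N2 {p q : ℕ} {T L : Type} (ψ : T → (L ≃ Fin (q + 1) × Bool)) (k : T × Fin (2 * p))
    (v : (Bool × ZMod (2 * p + 2)) × L) : (Bool × ZMod (2 * p + 2)) × L :=
  ((v.1.1, v.1.2 + mu p k.2 (ψ k.1 v.2).1 (ψ k.1 v.2).2),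
    (ψ k.1).symm ((ψ k.1 v.2).1, !(ψ k.1 v.2).2))

/-- Neighbour map, pure cross edges. -/
def N3 {n : ℕ} {L : Type} (c : L → ZMod n) (k : ZMod n) (v : (Bool × ZMod n) × L) :
    (Bool × ZMod n) × L :=
  ((!v.1.1, if v.1.1 then v.1.2 - (k + c v.2) else v.1.2 + (k + c v.2)), v.2)

/-- The vertices on which the row `r` uses an inner edge, in terms of the pair index. -/
def inn (p r i : ℕ) (σ : Bool) (x : ZMod (2 * p + 2)) (β : Bool) : Prop :=
  (r = 2 * i ∨ r = 2 * i + 1) ∧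
    (tau p (if σ then x - ((6 * i : ℕ) : ZMod (2 * p + 2)) else x) =
      (decide (r = 2 * i) ^^ β ^^ σ))

open Classical in
/-- New part for the mixed cross edges, in terms of the pair index. -/
noncomputable def move (p r i : ℕ) (s : Bool × ZMod (2 * p + 2)) (β : Bool) :
    Bool × ZMod (2 * p + 2) :=
  if inn p r i s.1 s.2 β then (s.1, s.2 + ((p + 1 : ℕ) : ZMod (2 * p + 2)))
  else (!s.1, if s.1 then s.2 - eps (2 * p + 2) r i (!β) else s.2 + eps (2 * p + 2) r i β)

/-- Neighbour map, mixed cross edges. -/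
noncomputable def N4 {p q : ℕ} {T L : Type} (ψ : T → (L ≃ Fin (q + 1) × Bool))
    (k : T × Fin (2 * p + 3)) (v : (Bool × ZMod (2 * p + 2)) × L) :
    (Bool × ZMod (2 * p + 2)) × L :=
  (move p k.2 (ψ k.1 v.2).1 v.1 (ψ k.1 v.2).2,
    (ψ k.1).symm ((ψ k.1 v.2).1, !(ψ k.1 v.2).2))

theorem half_ne (p : ℕ) : ((p + 1 : ℕ) : ZMod (2 * p + 2)) ≠ 0 := by
  intro h
  have h2 : ((p + 1 : ℕ) : ZMod (2 * p + 2)).val = p + 1 := ZMod.val_natCast_of_lt (by omega)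
  rw [h, ZMod.val_zero] at h2
  omega

theorem inn_half (p r i : ℕ) (σ : Bool) (x : ZMod (2 * p + 2)) (β : Bool) :
    inn p r i σ (x + ((p + 1 : ℕ) : ZMod (2 * p + 2))) (!β) ↔ inn p r i σ x β := by
  have h : ∀ y, tau p (y + ((p + 1 : ℕ) : ZMod (2 * p + 2))) = !tau p y := tau_half p
  unfold inn
  cases σ
  · simp only [if_false, Bool.false_eq_true, h]
    cases tau p x <;> cases β <;> cases decide (r = 2 * i) <;> simp
  · simp only [if_true, add_sub_right_comm, h]
    cases tau p (x - ((6 * i : ℕ) : ZMod (2 * p + 2))) <;> cases β <;>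
      cases decide (r = 2 * i) <;> simp

theorem eps_spec (n r i : ℕ) (β : Bool) (h : r = 2 * i ∨ r = 2 * i + 1) :
    eps n r i β = ((6 * i : ℕ) : ZMod n) := by
  rcases h with rfl | rfl
  · exact eps_spec0 n i β
  · exact eps_spec1 n i β

theorem inn_cross (p r i : ℕ) (x : ZMod (2 * p + 2)) (β : Bool) :
    inn p r i true (x + eps (2 * p + 2) r i β) (!β) ↔ inn p r i false x β := by
  unfold inn
  by_cases h : r = 2 * i ∨ r = 2 * i + 1
  · rw [eps_spec _ _ _ _ h]
    simp only [if_true, if_false, Bool.false_eq_true, add_sub_cancel_right]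
    cases tau p x <;> cases β <;> cases decide (r = 2 * i) <;> simp
  · simp [h]

theorem inn_cross' (p r i : ℕ) (x : ZMod (2 * p + 2)) (β : Bool) :
    inn p r i false (x - eps (2 * p + 2) r i (!β)) (!β) ↔ inn p r i true x β := by
  have := inn_cross p r i (x - eps (2 * p + 2) r i (!β)) (!β)
  simpa using this.symm

theorem move_move (p r i : ℕ) (s : Bool × ZMod (2 * p + 2)) (β : Bool) :
    move p r i (move p r i s β) (!β) = s := by
  obtain ⟨σ, x⟩ := s
  by_cases h : inn p r i σ x β
  · have h' := (inn_half p r i σ x β).2 h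
    have e := half_add p
    simp only [move, h, h', if_true]
    rw [add_assoc, e, add_zero]
  · cases σ
    · have h' := mt (inn_cross p r i x β).1 h
      simp [move, h, h']
    · have h' := mt (inn_cross' p r i x β).1 h
      simp [move, h, h']

theorem move_ne (p r i : ℕ) (s : Bool × ZMod (2 * p + 2)) (β : Bool) : s ≠ move p r i s β := by
  obtain ⟨σ, x⟩ := s
  by_cases h : inn p r i σ x β
  · simpa [move, h] using half_ne p
  · simp [move, h]

theorem inn_uniq {p r i i' : ℕ} {σ : Bool} {x : ZMod (2 * p + 2)} {β β' : Bool}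
    (h : inn p r i σ x β) (h' : inn p r i' σ x β') : i = i' ∧ β = β' := by
  obtain ⟨h1, h2⟩ := h
  obtain ⟨h1', h2'⟩ := h'
  have hi : i = i' := by omega
  subst hi
  refine ⟨rfl, ?_⟩
  rw [h2] at h2'
  revert h2'
  cases β <;> cases β' <;> cases σ <;> cases decide (r = 2 * i) <;> simp

theorem inn_or {p r i : ℕ} {σ : Bool} {x : ZMod (2 * p + 2)} {β β' : Bool}
    (hr : r = 2 * i ∨ r = 2 * i + 1) (h : ¬ inn p r i σ x β) (h' : ¬ inn p r i σ x β') :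
    β = β' := by
  unfold inn at h h'
  simp only [hr, true_and] at h h'
  revert h h'
  cases tau p (if σ then x - ((6 * i : ℕ) : ZMod (2 * p + 2)) else x) <;>
  cases β <;> cases β' <;> cases σ <;> cases decide (r = 2 * i) <;> simp

theorem move_inj {p q r i i' : ℕ} {s : Bool × ZMod (2 * p + 2)} {β β' : Bool}
    (hn : 4 * q ≤ 2 * p + 2) (hi : i < q) (hi' : i' < q)
    (h : move p r i s β = move p r i' s β') : i = i' ∧ β = β' := by
  obtain ⟨σ, x⟩ := s
  by_cases h1 : inn p r i σ x β <;> by_cases h3 : inn p r i' σ x β' <;>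
    simp only [move, h1, h3, if_true, if_false] at h
  · exact inn_uniq h1 h3
  · simp at h
  · simp at h
  · have key : ∀ γ γ', eps (2 * p + 2) r i γ = eps (2 * p + 2) r i' γ' → (γ = γ' → β = β') →
        i = i' ∧ β = β' := by
      intro γ γ' he hγ
      obtain ⟨rfl, h4⟩ := eps_inj _ q r i i' γ γ' hn hi hi' he
      refine ⟨rfl, ?_⟩
      rcases h4 with h4 | h4
      · exact hγ h4
      · exact inn_or h4 h1 h3
    cases σ
    · simp at h
      exact key _ _ h id
    · simp at h
      exact key _ _ h (by simp)

theorem exists_OF_core (p q : ℕ) (h : 2 * q + 1 ≤ p) : IsOF (2 * (2 * p + 2)) (2 * q + 2) := by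
  obtain ⟨ψ, hψ⟩ := oneFac q (Fin (2 * q + 2)) (by simp)
  obtain ⟨F, F1, F2, F3, F4⟩ := oneFacInv p (ZMod (2 * p + 2)) (by rw [ZMod.card])
  obtain ⟨c, hc⟩ : ∃ c : Fin (2 * q + 2) → ZMod (2 * p + 1), Function.Injective c := by
    obtain ⟨e⟩ := Function.Embedding.nonempty_of_card_le (α := Fin (2 * q + 2))
      (β := ZMod (2 * p + 1)) (by rw [ZMod.card, Fintype.card_fin]; omega)
    exact ⟨e, e.injective⟩
  obtain ⟨d, hd⟩ : ∃ d : Fin (2 * q + 2) → ZMod (2 * p + 2), Function.Injective d := by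
    obtain ⟨e⟩ := Function.Embedding.nonempty_of_card_le (α := Fin (2 * q + 2))
      (β := ZMod (2 * p + 2)) (by rw [ZMod.card, Fintype.card_fin]; omega)
    exact ⟨e, e.injective⟩
  let N : (ZMod (2 * p + 1) ⊕ (ZMod (2 * q + 1) × Fin (2 * p))) ⊕
      (ZMod (2 * p + 2) ⊕ (ZMod (2 * q + 1) × Fin (2 * p + 3))) →
      (Bool × ZMod (2 * p + 2)) × Fin (2 * q + 2) → (Bool × ZMod (2 * p + 2)) × Fin (2 * q + 2) :=
    Sum.elim (Sum.elim (N1 F c) (N2 ψ)) (Sum.elim (N3 d) (N4 ψ))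
  have hinv : ∀ k v, N k (N k v) = v := by
    rintro ((k | k) | (k | k)) ⟨⟨σ, x⟩, a⟩
    · simp [N, N1, F1]
    · simp [N, N2, mu_not]
    · cases σ <;> simp [N, N3]
    · simp [N, N4, move_move]
  -- coverage from the left half to the right half
  have hcross : ∀ x y a b, ∃ k, N k ((false, x), a) = ((true, y), b) := by
    intro x y a b
    by_cases hab : a = b
    · subst hab
      exact ⟨Sum.inr (Sum.inl (y - x - d a)), by simp [N, N3]⟩
    · obtain ⟨t, i, β, rfl, rfl⟩ := hψ a b hab
      obtain ⟨r, hr, he⟩ := eps_surj (2 * p + 2) (q + 1) i β (by omega) i.2 (y - x)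
      have fin : ∀ r ≤ 2 * p + 2, eps (2 * p + 2) r i β = y - x → ¬ inn p r i false x β →
          ∃ k, N k ((false, x), (ψ t).symm (i, β)) = ((true, y), (ψ t).symm (i, !β)) := by
        intro r hr he hin
        exact ⟨Sum.inr (Sum.inr (t, ⟨r, by omega⟩)), by simp [N, N4, move, hin, he]⟩
      by_cases hin : inn p r i false x β
      · have hsp := hin.1
        have hv := eps_spec (2 * p + 2) r i β hsp
        rcases hsp with hsp | hsp
        · refine fin (2 * i + 1) (by omega) ?_ ?_
          · rw [eps_spec1, ← hv, he]
          · have h2 := hin.2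
            rintro ⟨_, h3⟩
            rw [h2] at h3
            simp [hsp] at h3
        · refine fin (2 * i) (by omega) ?_ ?_
          · rw [eps_spec0, ← hv, he]
          · have h2 := hin.2
            rintro ⟨_, h3⟩
            rw [h2] at h3
            simp [hsp] at h3
      · exact fin r hr he hin
  refine isOF_of (by omega) (X := Bool × ZMod (2 * p + 2)) (L := Fin (2 * q + 2))
    ?_ ?_ ?_ N hinv ?_ ?_ ?_
  · simp [ZMod.card]
  · simp
  · simp only [Fintype.card_sum, Fintype.card_prod, ZMod.card, Fintype.card_fin]
    rw [show 2 * (2 * p + 2) - 1 = 4 * p + 3 by omega]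
    ring
  · rintro ((k | k) | (k | k)) ⟨⟨σ, x⟩, a⟩
    · simpa [N, N1] using F2 _ _
    · simpa [N, N2] using mu_ne _ _ _ _ (by omega)
    · simp [N, N3]
    · exact move_ne _ _ _ _ _
  · rintro ((k | k) | (k | k)) ⟨σ, x⟩ a b hab
    · simp only [N, N1, Sum.elim_inl, Prod.mk.injEq, true_and] at hab
      exact hc (add_left_cancel (F4 _ _ _ hab))
    · simp only [N, N2, Sum.elim_inl, Sum.elim_inr, Prod.mk.injEq, true_and, add_right_inj] at hab
      have := mu_inj _ _ _ _ _ _ k.2.2 (by omega) (by omega) hab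
      apply (ψ k.1).injective
      exact Prod.ext (Fin.ext this.1) this.2
    · apply hd
      cases σ <;> simpa [N, N3] using hab
    · have := move_inj (q := q + 1) (by omega) (by omega) (by omega) hab
      apply (ψ k.1).injective
      exact Prod.ext (Fin.ext this.1) this.2
  · rintro ⟨⟨σ, x⟩, a⟩ ⟨⟨σ', y⟩, b⟩ hne
    by_cases hσ : σ = σ'
    · subst hσ
      have hxy : x ≠ y := fun h => hne (by rw [h])
      by_cases hab : a = b
      · subst hab
        obtain ⟨k, hk⟩ := F3 x y hxy
        exact ⟨Sum.inl (Sum.inl (k - c a)), by simp [N, N1, hk]⟩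
      · obtain ⟨t, i, β, rfl, rfl⟩ := hψ a b hab
        by_cases hh : y - x = ((p + 1 : ℕ) : ZMod (2 * p + 2))
        · have hy : y = x + ((p + 1 : ℕ) : ZMod (2 * p + 2)) := by rw [← hh]; ring
          have fin : ∀ r ≤ 2 * p + 2, inn p r i σ x β →
              ∃ k, N k ((σ, x), (ψ t).symm (i, β)) = ((σ, y), (ψ t).symm (i, !β)) := by
            intro r hr hin
            exact ⟨Sum.inr (Sum.inr (t, ⟨r, by omega⟩)), by simp [N, N4, move, hin, hy]⟩
          by_cases hw : tau p (if σ then x - ((6 * (i : ℕ) : ℕ) : ZMod (2 * p + 2)) else x) =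
              (true ^^ β ^^ σ)
          · exact fin (2 * i) (by omega) ⟨Or.inl rfl, by rw [hw]; simp⟩
          · refine fin (2 * i + 1) (by omega) ⟨Or.inr rfl, ?_⟩
            revert hw
            rw [show decide (2 * (i : ℕ) + 1 = 2 * i) = false by simp]
            cases tau p (if σ then x - ((6 * (i : ℕ) : ℕ) : ZMod (2 * p + 2)) else x) <;>
              cases β <;> cases σ <;> simp
        · obtain ⟨j, hj, he⟩ := mu_surj p i β (by omega) (y - x) (sub_ne_zero.2 hxy.symm) hh
          exact ⟨Sum.inl (Sum.inr (t, ⟨j, hj⟩)), by simp [N, N2, he]⟩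
    · cases σ <;> cases σ'
      · exact absurd rfl hσ
      · exact hcross x y a b
      · obtain ⟨k, hk⟩ := hcross y x b a
        exact ⟨k, by rw [← hk, hinv]⟩
      · exact absurd rfl hσ

end OFProof

/-- For every even `g ≥ 2` and every even `n ≥ 2g`, an `OF(2n,g)` exists. -/
theorem exists_OF_two_n_even_even (n g : ℕ) (hg2 : 2 ≤ g) (hge : Even g)
    (hne : Even n) (hn : 2 * g ≤ n) : IsOF (2 * n) g := by

  obtain ⟨a, rfl⟩ := hge
  obtain ⟨b, rfl⟩ := hne
  have h := OFProof.exists_OF_core (b - 1) (a - 1) (by omega)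
  rw [show 2 * (b - 1) + 2 = b + b by omega, show 2 * (a - 1) + 2 = a + a by omega] at h
  exact h
end

section
/- Let g ∈ {2,3} and let n ≥ 2 be an integer. Then an OF(n,g) exists if and only if n > g and g·n is even. -/
/-- A partial colouring of the inflation (by the symbol set `A`) of the graph `R` on `V`,
with `N` colours. -/
def PCol (V A : Type) (R : V → V → Prop) (N : ℕ) : Prop :=
  ∃ (K : Type) (C : Finset K) (col : V → V → A → A → K),
    C.card = N ∧
    (∀ i j a b, R i j → col i j a b ∈ C) ∧
    (∀ i j a b, R i j → col i j a b = col j i b a) ∧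
    (∀ i j k a b c, R i j → R i k → col i j a b = col i k a c → j = k ∧ b = c) ∧
    (∀ i j a b a' b', R i j → col i j a b = col i j a' b' → a = a' ∧ b = b')

theorem PCol.mono {V A : Type} {R S : V → V → Prop} {N : ℕ} (h : PCol V A S N)
    (hRS : ∀ i j, R i j → S i j) : PCol V A R N := by
  obtain ⟨K, C, col, h0, h1, h2, h3, h4⟩ := h
  exact ⟨K, C, col, h0, fun i j a b h => h1 i j a b (hRS _ _ h),
    fun i j a b h => h2 i j a b (hRS _ _ h),
    fun i j k a b c h h' => h3 i j k a b c (hRS _ _ h) (hRS _ _ h'),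
    fun i j a b a' b' h => h4 i j a b a' b' (hRS _ _ h)⟩

theorem PCol.union {V A : Type} {R S : V → V → Prop} {N M : ℕ} (h : PCol V A R N)
    (h' : PCol V A S M) (hR : ∀ i j, R i j → R j i) :
    PCol V A (fun i j => R i j ∨ S i j) (N + M) := by
  classical
  obtain ⟨K, C, col, h0, h1, h2, h3, h4⟩ := h
  obtain ⟨K', C', col', h0', h1', h2', h3', h4'⟩ := h'
  refine ⟨K ⊕ K', C.disjSum C',
    fun i j a b => if R i j then Sum.inl (col i j a b) else Sum.inr (col' i j a b),
    by simp [h0, h0'], ?_, ?_, ?_, ?_⟩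
  · intro i j a b h
    by_cases hr : R i j
    · simpa [hr] using h1 _ _ _ _ hr
    · simpa [hr] using h1' _ _ _ _ (h.resolve_left hr)
  · intro i j a b h
    by_cases hr : R i j
    · simpa [hr, hR _ _ hr] using h2 _ _ _ _ hr
    · have hr' : ¬ R j i := fun h => hr (hR _ _ h)
      simpa [hr, hr'] using h2' _ _ _ _ (h.resolve_left hr)
  · intro i j k a b c h h' he
    by_cases hr : R i j <;> by_cases hr' : R i k <;> simp [hr, hr'] at he
    · exact h3 _ _ _ _ _ _ hr hr' he
    · exact h3' _ _ _ _ _ _ (h.resolve_left hr) (h'.resolve_left hr') he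
  · intro i j a b a' b' h he
    by_cases hr : R i j <;> simp [hr] at he
    · exact h4 _ _ _ _ _ _ hr he
    · exact h4' _ _ _ _ _ _ (h.resolve_left hr) he

theorem PCol.transport {V A V' A' : Type} {N : ℕ} (h : PCol V A (· ≠ ·) N)
    (e : V' ≃ V) (f : A' ≃ A) : PCol V' A' (· ≠ ·) N := by
  obtain ⟨K, C, col, h0, h1, h2, h3, h4⟩ := h
  refine ⟨K, C, fun i j a b => col (e i) (e j) (f a) (f b), h0, ?_, ?_, ?_, ?_⟩
  · intro i j a b h
    exact h1 _ _ _ _ (by simpa using h)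
  · intro i j a b h
    exact h2 _ _ _ _ (by simpa using h)
  · intro i j k a b c h h' he
    simpa using h3 _ _ _ _ _ _ (by simpa using h) (by simpa using h') he
  · intro i j a b a' b' h he
    simpa using h4 _ _ _ _ _ _ (by simpa using h) he

/-- Regular packets: classes `1, …, h`, each a graph with locally injective half-edge labels and
a proper vertex colouring by types. -/
theorem PCol.packet {V A S τ : Type} [AddCommGroup A] [Fintype S] {R : V → V → Prop}
    (ev : τ → S → A) (sol : τ → τ → A → A → S)
    (hsol : ∀ c c' a b, c ≠ c' → ev c (sol c c' a b) = a ∧ ev c' (sol c c' a b) = b)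
    (hsym : ∀ c c' a b, c ≠ c' → sol c c' a b = sol c' c b a)
    (hR : ∀ i j, R i j → R j i)
    (h : ℕ) (cls : V → V → ℕ) (ty : ℕ → V → τ) (lab : V → V → A)
    (hc : ∀ i j, R i j → cls i j = cls j i) (hc1 : ∀ i j, R i j → cls i j ∈ Finset.Icc 1 h)
    (hty : ∀ i j, R i j → ty (cls i j) i ≠ ty (cls i j) j)
    (hlab : ∀ i j k, R i j → R i k → cls i j = cls i k → lab i j = lab i k → j = k) :
    PCol V A R (h * Fintype.card S) := by
  refine ⟨ℕ × S, Finset.Icc 1 h ×ˢ Finset.univ, fun i j a b =>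
    (cls i j, sol (ty (cls i j) i) (ty (cls i j) j) (a - lab i j) (b - lab j i)),
    by simp, ?_, ?_, ?_, ?_⟩
  · intro i j a b hr
    simpa using hc1 i j hr
  · intro i j a b hr
    simp only [Prod.mk.injEq]
    refine ⟨hc i j hr, ?_⟩
    rw [← hc i j hr]
    exact hsym _ _ _ _ (hty i j hr)
  · intro i j k a b c hr hr' he
    simp only [Prod.mk.injEq] at he
    obtain ⟨he1, he2⟩ := he
    have e1 := hsol _ _ (a - lab i j) (b - lab j i) (hty i j hr)
    have e2 := hsol _ _ (a - lab i k) (c - lab k i) (hty i k hr')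
    have : lab i j = lab i k := by
      have := e1.1
      rw [he2, he1, e2.1] at this
      simpa using this.symm
    have hjk := hlab i j k hr hr' he1 this
    subst hjk
    refine ⟨rfl, ?_⟩
    have := e1.2
    rw [he2, e2.2] at this
    simpa using this.symm
  · intro i j a b a' b' hr he
    simp only [Prod.mk.injEq, true_and] at he
    have e1 := hsol _ _ (a - lab i j) (b - lab j i) (hty i j hr)
    have e2 := hsol _ _ (a' - lab i j) (b' - lab j i) (hty i j hr)
    rw [he] at e1
    constructor
    · simpa using e1.1.symm.trans e2.1
    · simpa using e1.2.symm.trans e2.2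

/-- the difference of a cross edge, from level `false` to level `true` -/
def xdiff {m : ℕ} (u v : ZMod m × Bool) : ℕ :=
  if u.2 = false then (v.1 - u.1).val else (u.1 - v.1).val

theorem PCol.bip (m k g : ℕ) [NeZero m] [NeZero k] [NeZero g] (hg : g ≤ k) :
    PCol (ZMod m × Bool) (ZMod g) (fun u v => u.2 ≠ v.2 ∧ xdiff u v < k) (k * g) := by
  have inj1 : ∀ x y : ℕ, x < k → y < k → (x : ZMod k) = y → x = y := by
    intro x y hx hy h
    have := congrArg ZMod.val h
    rwa [ZMod.val_natCast_of_lt hx, ZMod.val_natCast_of_lt hy] at this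
  have inj2 : ∀ a b : ZMod g, (a.val : ZMod k) = b.val → a = b := by
    intro a b h
    exact ZMod.val_injective g (inj1 _ _ (a.val_lt.trans_le hg) (b.val_lt.trans_le hg) h)
  let F : ℕ → ZMod g → ZMod g → ZMod k × ZMod g := fun e a b => ((e : ZMod k) - a.val, b - a)
  have FP : ∀ e e' a b c, e < k → e' < k → F e a b = F e' a c → e = e' ∧ b = c := by
    intro e e' a b c he he' h
    simp only [F, Prod.mk.injEq, sub_left_inj] at h
    exact ⟨inj1 _ _ he he' h.1, h.2⟩
  have FQ : ∀ e e' a b c, e < k → e' < k → F e b a = F e' c a → e = e' ∧ b = c := by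
    intro e e' a b c he he' h
    simp only [F, Prod.mk.injEq, sub_right_inj] at h
    obtain ⟨h1, rfl⟩ := h
    simp only [sub_left_inj] at h1
    exact ⟨inj1 _ _ he he' h1, rfl⟩
  have FR : ∀ e a b a' b', F e a b = F e a' b' → a = a' ∧ b = b' := by
    intro e a b a' b' h
    simp only [F, Prod.mk.injEq, sub_right_inj] at h
    have := inj2 _ _ h.1
    subst this
    simpa using h.2
  refine ⟨ZMod k × ZMod g, Finset.univ, fun u v a b =>
    if u.2 = false then F (xdiff u v) a b else F (xdiff u v) b a, ?_, ?_, ?_, ?_, ?_⟩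
  · simp [ZMod.card]
  · simp
  · rintro ⟨x, i⟩ ⟨y, j⟩ a b ⟨h, -⟩
    cases i <;> cases j <;> simp [xdiff] at h ⊢
  · rintro ⟨x, i⟩ ⟨y, j⟩ ⟨z, l⟩ a b c ⟨h, h1⟩ ⟨h', h1'⟩ he
    cases i <;> cases j <;> cases l <;> simp [xdiff] at h h' h1 h1' he ⊢
    · have := FP _ _ _ _ _ h1 h1' he
      exact ⟨by simpa using ZMod.val_injective m this.1, this.2⟩
    · have := FQ _ _ _ _ _ h1 h1' he
      exact ⟨by simpa using ZMod.val_injective m this.1, this.2⟩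
  · rintro ⟨x, i⟩ ⟨y, j⟩ a b a' b' ⟨h, h1⟩ he
    cases i <;> cases j <;> simp [xdiff] at h he
    · exact FR _ _ _ _ _ he
    · exact (FR _ _ _ _ _ he).symm

theorem PCol.levels {V A : Type} {N : ℕ} (h : PCol V A (· ≠ ·) N) :
    PCol (V × Bool) A (fun u v => u.2 = v.2 ∧ u.1 ≠ v.1) N := by
  obtain ⟨K, C, col, h0, h1, h2, h3, h4⟩ := h
  refine ⟨K, C, fun i j a b => col i.1 j.1 a b, h0, ?_, ?_, ?_, ?_⟩
  · intro i j a b h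
    exact h1 _ _ _ _ h.2
  · intro i j a b h
    exact h2 _ _ _ _ h.2
  · intro i j k a b c h h' he
    have := h3 _ _ _ _ _ _ h.2 h'.2 he
    exact ⟨Prod.ext this.1 (h.1.symm.trans h'.1), this.2⟩
  · intro i j a b a' b' h he
    exact h4 _ _ _ _ _ _ h.2 he

def Good (g n : ℕ) : Prop := PCol (ZMod n) (ZMod g) (· ≠ ·) (g * (n - 1))

theorem Good.double {g m : ℕ} [NeZero g] (hg : g ≤ m) (h : Good g m) : Good g (2 * m) := by
  have : NeZero m := ⟨by have := NeZero.ne g; omega⟩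
  have H := h.levels.union (PCol.bip m m g hg) (by
    intro i j h; exact ⟨h.1.symm, h.2.symm⟩)
  have e : ZMod (2 * m) ≃ ZMod m × Bool := Fintype.equivOfCardEq (by simp [ZMod.card, mul_comm])
  have H2 := (H.mono (R := (· ≠ ·)) (by
    rintro ⟨x, i⟩ ⟨y, j⟩ h
    by_cases hij : i = j
    · left; simpa [hij] using h
    · right
      refine ⟨hij, ?_⟩
      unfold xdiff
      split_ifs <;> exact ZMod.val_lt _)).transport e (Equiv.refl _)
  unfold Good
  convert H2 using 1
  obtain ⟨t, rfl⟩ : ∃ t, m = t + 1 := ⟨m - 1, by have := NeZero.ne m; omega⟩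
  have : 2 * (t + 1) - 1 = 2 * t + 1 := by omega
  rw [this]
  simp
  ring

/-- 3-colouring of the circulant of difference `d` on `m` points -/
def c3 (m d x : ℕ) : ℕ := if m ≤ x + d then 2 else (x / d) % 2

theorem c3_lt (m d x : ℕ) : c3 m d x < 3 := by
  unfold c3; split_ifs <;> omega

theorem c3_ne {m d x y : ℕ} (hd : 1 ≤ d) (hm : 2 * d < m) (hx : x < m)
    (h : y = x + d ∨ y + m = x + d) (hy : y < m) : c3 m d x ≠ c3 m d y := by
  unfold c3
  rcases h with rfl | h
  · rw [Nat.add_div_right _ (by omega)]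
    split_ifs <;> omega
  · have : y / d = 0 := Nat.div_eq_of_lt (by omega)
    rw [this]
    split_ifs <;> omega

theorem val_sub_add {m : ℕ} [NeZero m] (x y : ZMod m) (h : x ≠ y) :
    (x - y).val + (y - x).val = m := by
  have h1 : y - x ≠ 0 := sub_ne_zero.2 h.symm
  haveI : NeZero (y - x) := ⟨h1⟩
  have := ZMod.val_neg_of_ne_zero (y - x)
  rw [neg_sub] at this
  have := (y - x).val_lt
  omega

theorem val_sub_cases {m : ℕ} [NeZero m] (x y : ZMod m) :
    y.val = x.val + (y - x).val ∨ y.val + m = x.val + (y - x).val := by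
  have h : (x + (y - x)).val = (x.val + (y - x).val) % m := ZMod.val_add _ _
  rw [add_sub_cancel] at h
  have := x.val_lt
  have := (y - x).val_lt
  by_cases hh : x.val + (y - x).val < m
  · rw [Nat.mod_eq_of_lt hh] at h; omega
  · rw [Nat.mod_eq_sub_mod (by omega), Nat.mod_eq_of_lt (by omega)] at h; omega

def dist0 {m : ℕ} (x y : ZMod m) : ℕ := min (y - x).val (x - y).val

theorem dist0_comm {m : ℕ} (x y : ZMod m) : dist0 x y = dist0 y x := min_comm _ _

theorem dist0_mem {h : ℕ} (x y : ZMod (2 * h + 1)) (hxy : x ≠ y) :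
    dist0 x y ∈ Finset.Icc 1 h := by
  have h1 := val_sub_add x y hxy
  have h2 := (x - y).val_lt
  have h3 := (y - x).val_lt
  rw [Finset.mem_Icc]; unfold dist0; omega

theorem dist0_c3 {h : ℕ} (x y : ZMod (2 * h + 1)) (hxy : x ≠ y) :
    c3 (2 * h + 1) (dist0 x y) x.val ≠ c3 (2 * h + 1) (dist0 x y) y.val := by
  have h1 := val_sub_add x y hxy
  have h2 := (x - y).val_lt
  have h3 := (y - x).val_lt
  have hx := x.val_lt
  have hy := y.val_lt
  have h4 := val_sub_cases x y
  have h5 := val_sub_cases y x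
  have h6 := Finset.mem_Icc.1 (dist0_mem x y hxy)
  rcases le_total (y - x).val (x - y).val with hle | hle
  · have : dist0 x y = (y - x).val := min_eq_left hle
    exact c3_ne (by omega) (by omega) hx (by omega) hy
  · have : dist0 x y = (x - y).val := min_eq_right hle
    exact (c3_ne (by omega) (by omega) hy (by omega) hx).symm

def lab0 {m : ℕ} (h : ℕ) (x y : ZMod m) : ℕ := if (y - x).val ≤ h then 0 else 1

theorem lab0_inj {h : ℕ} (x y z : ZMod (2 * h + 1)) (hxy : x ≠ y) (hxz : x ≠ z)
    (hd : dist0 x y = dist0 x z) (hl : lab0 h x y = lab0 h x z) : y = z := by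
  have h1 := val_sub_add x y hxy
  have h2 := val_sub_add x z hxz
  have : (y - x).val = (z - x).val := by
    unfold dist0 at hd
    unfold lab0 at hl
    split_ifs at hl <;> omega
  simpa using ZMod.val_injective _ this

theorem lab0_lt {m h : ℕ} (x y : ZMod m) : lab0 h x y < 2 := by
  unfold lab0; split_ifs <;> omega

/-! ### `g = 2`, `n` odd -/

def ev2 (c : Fin 3) (s : ZMod 2 × ZMod 2) : ZMod 2 :=
  if c = 0 then s.1 else if c = 1 then s.2 else s.1 + s.2

def sol2 (c c' : Fin 3) (a b : ZMod 2) : ZMod 2 × ZMod 2 :=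
  if c = 0 then (if c' = 1 then (a, b) else (a, a + b))
  else if c = 1 then (if c' = 0 then (b, a) else (a + b, a))
  else (if c' = 0 then (b, a + b) else (a + b, b))

theorem good_two_odd (h : ℕ) : Good 2 (2 * h + 1) := by
  have H := PCol.packet (V := ZMod (2 * h + 1)) (R := (· ≠ ·)) ev2 sol2 (by decide) (by decide)
    (fun i j hij => hij.symm) h dist0
    (fun d x => ⟨c3 (2 * h + 1) d x.val, c3_lt _ _ _⟩) (fun x y => (lab0 h x y : ZMod 2))
    (fun i j _ => dist0_comm i j) dist0_mem
    (by
      intro i j hij he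
      exact dist0_c3 i j hij (by simpa using he))
    (by
      intro i j k hij hik hd hl
      refine lab0_inj i j k hij hik hd ?_
      have := congrArg ZMod.val hl
      rwa [ZMod.val_natCast_of_lt (lab0_lt _ _), ZMod.val_natCast_of_lt (lab0_lt _ _)] at this)
  unfold Good
  convert H using 1
  simp [ZMod.card]; ring

/-! ### `g = 3`, `n = 2 m`, `m` odd -/

def ev3 (c : ZMod 3) (s : ZMod 3 × ZMod 3) : ZMod 3 := c * s.1 + s.2

def sol3 (c c' : ZMod 3) (a b : ZMod 3) : ZMod 3 × ZMod 3 :=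
  ((c - c') * (a - b), a - c * ((c - c') * (a - b)))

def prismR (h : ℕ) (u v : ZMod (2 * h + 1) × Bool) : Prop :=
  (u.2 = v.2 ∧ u.1 ≠ v.1) ∨ (u.2 ≠ v.2 ∧ h + 1 ≤ xdiff u v)

theorem prismR_symm (h : ℕ) (u v : ZMod (2 * h + 1) × Bool) (H : prismR h u v) :
    prismR h v u := by
  obtain ⟨x, i⟩ := u
  obtain ⟨y, j⟩ := v
  cases i <;> cases j <;> simp [prismR, xdiff] at H ⊢
  · exact fun h => H h.symm
  · exact H
  · exact H
  · exact fun h => H h.symm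

theorem prism (h : ℕ) :
    PCol (ZMod (2 * h + 1) × Bool) (ZMod 3) (prismR h) (h * 9) := by
  have cast_inj : ∀ a b : ℕ, a < 3 → b < 3 → (a : ZMod 3) = b → a = b := by
    intro a b ha hb hab
    have := congrArg ZMod.val hab
    rwa [ZMod.val_natCast_of_lt ha, ZMod.val_natCast_of_lt hb] at this
  have H := PCol.packet (V := ZMod (2 * h + 1) × Bool) (R := prismR h) ev3 sol3
    (by decide) (by decide) (prismR_symm h) h
    (fun u v => if u.2 = v.2 then dist0 u.1 v.1 else xdiff u v - h)
    (fun d u => if u.2 = false then (c3 (2 * h + 1) d u.1.val : ZMod 3)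
      else (c3 (2 * h + 1) d (u.1 - ((h + d : ℕ) : ZMod (2 * h + 1))).val : ZMod 3) + 1)
    (fun u v => if u.2 = v.2 then (lab0 h u.1 v.1 : ZMod 3) else ((2 : ℕ) : ZMod 3))
    ?_ ?_ ?_ ?_
  · simpa [ZMod.card] using H
  · rintro ⟨x, i⟩ ⟨y, j⟩ -
    cases i <;> cases j <;> simp [xdiff, dist0_comm x y]
  · rintro ⟨x, i⟩ ⟨y, j⟩ H
    have hv1 := (x - y).val_lt
    have hv2 := (y - x).val_lt
    cases i <;> cases j <;> simp only [prismR, xdiff] at H ⊢ <;> simp at H ⊢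
    · simpa using dist0_mem x y H
    · omega
    · omega
    · simpa using dist0_mem x y H
  · have key : ∀ x y : ZMod (2 * h + 1), h + 1 ≤ (y - x).val →
        y - ((h + ((y - x).val - h) : ℕ) : ZMod (2 * h + 1)) = x := by
      intro x y hh
      rw [show h + ((y - x).val - h) = (y - x).val by omega, ZMod.natCast_zmod_val]
      ring
    rintro ⟨x, i⟩ ⟨y, j⟩ H
    cases i <;> cases j <;> simp only [prismR, xdiff] at H ⊢ <;> simp at H
    · simp only [if_true]
      intro he
      exact dist0_c3 x y H (cast_inj _ _ (c3_lt _ _ _) (c3_lt _ _ _) he)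
    · have := key x y (by omega)
      simp only [if_true, Bool.false_eq_true, Bool.true_eq_false, if_false, reduceCtorEq]
      rw [this]
      simp
    · have := key y x (by omega)
      simp only [if_true, Bool.false_eq_true, Bool.true_eq_false, if_false, reduceCtorEq]
      rw [this]
      simp
    · simp only [if_true, Bool.false_eq_true, Bool.true_eq_false, if_false, reduceCtorEq]
      intro he
      have he := add_right_cancel he
      set r : ZMod (2 * h + 1) := ((h + dist0 x y : ℕ) : ZMod (2 * h + 1)) with hr
      have hd : dist0 (x - r) (y - r) = dist0 x y := by simp [dist0]
      have := dist0_c3 (x - r) (y - r) (by simpa using H)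
      rw [hd] at this
      exact this (cast_inj _ _ (c3_lt _ _ _) (c3_lt _ _ _) he)
  · have l2 : ∀ x y : ZMod (2 * h + 1), (lab0 h x y : ZMod 3) ≠ ((2 : ℕ) : ZMod 3) := by
      intro x y he
      have h1 := lab0_lt (h := h) x y
      have := cast_inj _ _ (by omega) (by omega) he
      omega
    have l1 : ∀ x y z : ZMod (2 * h + 1), x ≠ y → x ≠ z → dist0 x y = dist0 x z →
        (lab0 h x y : ZMod 3) = lab0 h x z → y = z := by
      intro x y z hxy hxz hd he
      have h1 := lab0_lt (h := h) x y
      have h2 := lab0_lt (h := h) x z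
      exact lab0_inj x y z hxy hxz hd (cast_inj _ _ (by omega) (by omega) he)
    have l3 : ∀ x y : ZMod (2 * h + 1), h + 1 ≤ x.val → h + 1 ≤ y.val →
        x.val - h = y.val - h → x = y := by
      intro x y hx hy he
      exact ZMod.val_injective _ (by omega)
    rintro ⟨x, i⟩ ⟨y, j⟩ ⟨z, k⟩ H H' hc hl
    cases i <;> cases j <;> cases k <;>
      simp only [prismR, xdiff, if_true, Bool.false_eq_true, Bool.true_eq_false, if_false,
        reduceCtorEq, ne_eq, not_true_eq_false, not_false_eq_true, true_and, false_and, or_false,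
        false_or, Prod.mk.injEq, and_true, and_false] at H H' hc hl ⊢
    · exact l1 x y z H H' hc hl
    · exact l2 _ _ hl
    · exact l2 _ _ hl.symm
    · simpa using l3 _ _ H H' hc
    · simpa using l3 _ _ H H' hc
    · exact l2 _ _ hl.symm
    · exact l2 _ _ hl
    · exact l1 x y z H H' hc hl

theorem good_three_twice_odd (h : ℕ) (hh : 2 ≤ h) : Good 3 (2 * (2 * h + 1)) := by
  have H := (prism h).union (PCol.bip (2 * h + 1) (h + 1) 3 (by omega)) (prismR_symm h)
  have e : ZMod (2 * (2 * h + 1)) ≃ ZMod (2 * h + 1) × Bool :=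
    Fintype.equivOfCardEq (by simp [ZMod.card, mul_comm])
  have H2 := (H.mono (R := (· ≠ ·)) (by
    rintro ⟨x, i⟩ ⟨y, j⟩ hne
    by_cases hij : i = j
    · left; left; simpa [hij] using hne
    · rcases le_or_gt (h + 1) (xdiff (x, i) (y, j)) with hle | hlt
      · left; right; exact ⟨hij, hle⟩
      · right; exact ⟨hij, hlt⟩)).transport e (Equiv.refl _)
  unfold Good
  convert H2 using 1
  omega

/-! ### Small cases -/

/-- colour table packed in base 16 -/
def tab (T n g : ℕ) (i j : Fin n) (a b : Fin g) : ℕ :=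
  T / 16 ^ (((i.val * n + j.val) * g + a.val) * g + b.val) % 16

theorem good_of_tab (T n g : ℕ) [NeZero n] [NeZero g]
    (h1 : ∀ i j a b, i ≠ j → tab T n g i j a b < g * (n - 1))
    (h2 : ∀ i j a b, i ≠ j → tab T n g i j a b = tab T n g j i b a)
    (h3 : ∀ i j, i ≠ j → ∀ k, i ≠ k → ∀ a b c,
      tab T n g i j a b = tab T n g i k a c → j = k ∧ b = c)
    (h4 : ∀ i j, i ≠ j → ∀ a b a' b',
      tab T n g i j a b = tab T n g i j a' b' → a = a' ∧ b = b') : Good g n := by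
  have H : PCol (Fin n) (Fin g) (· ≠ ·) (g * (n - 1)) :=
    ⟨ℕ, Finset.range (g * (n - 1)), tab T n g, by simp, by simpa using h1, h2,
      fun i j k a b c h h' => h3 i j h k h' a b c, fun i j a b a' b' h => h4 i j h a b a' b'⟩
  exact H.transport (Fintype.equivOfCardEq (by simp [ZMod.card]))
    (Fintype.equivOfCardEq (by simp [ZMod.card]))

theorem good_2_4 : Good 2 4 :=
  good_of_tab 0x31524031524013500005241430220435421000031501254403235100000 4 2
    (by decide +kernel) (by decide +kernel) (by decide +kernel) (by decide +kernel)

theorem good_3_4 : Good 3 4 :=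
  good_of_tab 0x716024358345186027028357146703125648000000000461738502285604713310482567475630182000000000862571430031254876267801543854673210000000000 4 3
    (by decide +kernel) (by decide +kernel) (by decide +kernel) (by decide +kernel)

theorem good_3_6 : Good 3 6 :=
  good_of_tab 0xcb79e6845da3c821e781405a23b925374d0606e1bda9cc98be4765000000000a3192deb0ed7c063a1052138c4d64b75a829dc1a8e327a9e32b1d0000000000b25d604894675c9eba3084175c68021534abec3d0a761bd42685090000000006a179b8ec975ce42d393d27054601c53428d45e6cb79a678a9e1bc000000000ba2d81e3001a6b9edc678452ba934501c8769c27ed543bdea83210000000000 6 3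
    (by decide +kernel) (by decide +kernel) (by decide +kernel) (by decide +kernel)

theorem good_two (n : ℕ) (hn : 3 ≤ n) : Good 2 n := by
  induction n using Nat.strong_induction_on with
  | _ n ih =>
    rcases Nat.even_or_odd' n with ⟨m, rfl | rfl⟩
    · rcases Nat.lt_or_ge m 3 with hm | hm
      · obtain rfl : m = 2 := by omega
        exact good_2_4
      · exact (ih m (by omega) hm).double (by omega)
    · exact good_two_odd m

theorem good_three (n : ℕ) (hn : 4 ≤ n) (he : Even n) : Good 3 n := by
  induction n using Nat.strong_induction_on with
  | _ n ih =>
    obtain ⟨m, rfl⟩ := even_iff_two_dvd.1 he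
    rcases Nat.even_or_odd' m with ⟨h, rfl | rfl⟩
    · rcases Nat.lt_or_ge h 2 with hm | hm
      · obtain rfl : h = 1 := by omega
        exact good_3_4
      · exact (ih (2 * h) (by omega) (by omega) (even_two_mul h)).double (by omega)
    · rcases Nat.lt_or_ge h 2 with hm | hm
      · obtain rfl : h = 1 := by omega
        exact good_3_6
      · exact good_three_twice_odd h hm

/-! ### Words -/

def word {n g : ℕ} (i j : Fin n) (a b : Fin g) : Fin n → Fin (g + 1) :=
  fun k => if k = i then a.succ else if k = j then b.succ else 0

theorem word_comm {n g : ℕ} (i j : Fin n) (a b : Fin g) (h : i ≠ j) :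
    word i j a b = word j i b a := by
  funext k
  unfold word
  split_ifs with h1 h2
  · exact absurd (h1.symm.trans h2) h
  all_goals rfl

theorem three_le_dist_s16 {n q : ℕ} (x y : Fin n → Fin q) (i j k : Fin n) (hij : i ≠ j) (hik : i ≠ k)
    (hjk : j ≠ k) (hi : x i ≠ y i) (hj : x j ≠ y j) (hk : x k ≠ y k) : 3 ≤ hammingDist x y := by
  have : ({i, j, k} : Finset (Fin n)).card = 3 := Finset.card_eq_three.2 ⟨i, j, k, hij, hik, hjk, rfl⟩
  rw [← this]
  unfold hammingDist
  apply Finset.card_le_card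
  intro t
  simp only [Finset.mem_insert, Finset.mem_singleton, Finset.mem_filter, Finset.mem_univ, true_and]
  rintro (rfl | rfl | rfl) <;> assumption

theorem dist_share {n g : ℕ} (i j k : Fin n) (a b a' c : Fin g) (hij : i ≠ j) (hik : i ≠ k)
    (hjk : j ≠ k) (ha : a ≠ a') : 3 ≤ hammingDist (word i j a b) (word i k a' c) := by
  apply three_le_dist_s16 _ _ i j k hij hik hjk
  · simpa [word] using ha
  · simp [word, hij.symm, hjk]
  · simp [word, hik.symm, hjk.symm, (Fin.succ_ne_zero _).symm]

theorem dist_disj {n g : ℕ} (i j k l : Fin n) (a b a' c : Fin g) (hij : i ≠ j) (hik : i ≠ k)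
    (hil : i ≠ l) (hjk : j ≠ k) (hjl : j ≠ l) :
    3 ≤ hammingDist (word i j a b) (word k l a' c) := by
  apply three_le_dist_s16 _ _ i j k hij hik hjk
  · simp [word, hik, hil]
  · simp [word, hij.symm, hjk, hjl]
  · simp [word, hik.symm, hjk.symm, (Fin.succ_ne_zero _).symm]

abbrev Quad (n g : ℕ) := (Fin n × Fin n) × (Fin g × Fin g)

def quads (n g : ℕ) : Finset (Quad n g) := Finset.univ.filter (fun q => q.1.1 < q.1.2)

def qword {n g : ℕ} (q : Quad n g) : Fin n → Fin (g + 1) := word q.1.1 q.1.2 q.2.1 q.2.2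

theorem qword_supp {n g : ℕ} (q : Quad n g) :
    (Finset.univ.filter (fun t => ((qword q t : Fin (g + 1)) : ℕ) ≠ 0)) = {q.1.1, q.1.2} := by
  ext t
  rw [Finset.mem_filter]
  simp only [Finset.mem_univ, true_and, Finset.mem_insert,
    Finset.mem_singleton, qword, word]
  split_ifs with h1 h2 <;> simp [h1, *]

theorem quads_card (n g : ℕ) : 2 * (quads n g).card = g * (n - 1) * (g * n) := by
  have h1 : quads n g = (Finset.univ.filter (fun p : Fin n × Fin n => p.1 < p.2)) ×ˢ Finset.univ := by
    ext q; simp [quads]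
  have h2 : (Finset.univ.filter (fun p : Fin n × Fin n => p.1 < p.2)).card * 2 = n * (n - 1) := by
    rw [← Finset.sum_range_id_mul_two, ← Fin.sum_univ_eq_sum_range (fun i => i) n]
    congr 1
    rw [Finset.card_filter, ← Finset.univ_product_univ, Finset.sum_product_right]
    refine Finset.sum_congr rfl fun j _ => ?_
    rw [← Finset.card_filter]
    have : (Finset.univ.filter (fun i : Fin n => i < j)) = Finset.Iio j := by ext; simp
    rw [this, Fin.card_Iio]
  rw [h1, Finset.card_product]
  simp only [Finset.card_univ, Fintype.card_prod, Fintype.card_fin]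
  calc _ = ((Finset.univ.filter (fun p : Fin n × Fin n => p.1 < p.2)).card * 2) * (g * g) := by ring
    _ = _ := by rw [h2]; ring

theorem qword_inj {n g : ℕ} {q r : Quad n g} (hq : q ∈ quads n g) (hr : r ∈ quads n g)
    (h : qword q = qword r) : q = r := by
  have hs := qword_supp q
  rw [h, qword_supp r] at hs
  obtain ⟨⟨i, j⟩, a, b⟩ := q
  obtain ⟨⟨i', j'⟩, a', b'⟩ := r
  simp only [quads, Finset.mem_filter, Finset.mem_univ, true_and] at hq hr
  simp only at hs
  have e1 : i ∈ ({i', j'} : Finset (Fin n)) := by rw [hs]; simp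
  have e2 : j ∈ ({i', j'} : Finset (Fin n)) := by rw [hs]; simp
  simp only [Finset.mem_insert, Finset.mem_singleton] at e1 e2
  have hi : i = i' := by omega
  have hj : j = j' := by omega
  subst hi hj
  have f1 := congrFun h i
  have f2 := congrFun h j
  simp [qword, word, hq.ne'] at f1 f2
  simp [f1, f2]

theorem image_quads (n g : ℕ) : (quads n g).image qword = weightTwoWords n g := by
  ext x
  simp only [Finset.mem_image, weightTwoWords, Finset.mem_filter, Finset.mem_univ, true_and]
  constructor
  · rintro ⟨q, hq, rfl⟩
    simp only [quads, Finset.mem_filter, Finset.mem_univ, true_and] at hq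
    unfold wordWeight
    rw [qword_supp, Finset.card_pair hq.ne]
  · intro hx
    unfold wordWeight at hx
    obtain ⟨i, j, hij, hs⟩ := Finset.card_eq_two.1 hx
    wlog hlt : i < j generalizing i j
    · exact this j i hij.symm (by rw [hs, Finset.pair_comm]) (by omega)
    have hz : ∀ t, x t ≠ 0 ↔ t = i ∨ t = j := by
      intro t
      have : t ∈ Finset.univ.filter (fun t => (x t : ℕ) ≠ 0) ↔ t ∈ ({i, j} : Finset (Fin n)) := by
        rw [hs]
      rw [Finset.mem_filter, Finset.mem_insert, Finset.mem_singleton] at this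
      rw [← this]
      simp only [Finset.mem_univ, true_and, ne_eq, Fin.ext_iff, Fin.val_zero]
    obtain ⟨a, ha⟩ := Fin.exists_succ_eq.2 ((hz i).2 (Or.inl rfl))
    obtain ⟨b, hb⟩ := Fin.exists_succ_eq.2 ((hz j).2 (Or.inr rfl))
    refine ⟨((i, j), (a, b)), by simpa [quads] using hlt, ?_⟩
    funext t
    simp only [qword, word]
    split_ifs with h1 h2
    · rw [h1, ha]
    · rw [h2, hb]
    · by_contra hne
      rcases (hz t).1 (fun h => hne h.symm) with h | h
      · exact h1 h
      · exact h2 h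

theorem card_weightTwo (n g : ℕ) : 2 * (weightTwoWords n g).card = g * (n - 1) * (g * n) := by
  rw [← image_quads, Finset.card_image_of_injOn, quads_card]
  intro q hq r hr h
  exact qword_inj hq hr h

theorem isOF_of_pcol (n g : ℕ) (he : Even (g * n))
    (H : PCol (Fin n) (Fin g) (· ≠ ·) (g * (n - 1))) : IsOF n g := by
  classical
  obtain ⟨K, C, col, h0, h1, h2, h3, h4⟩ := H
  obtain ⟨s, hs⟩ := he
  have hs2 : g * n / 2 = s := by omega
  unfold IsOF HasDist3Partition
  rw [hs2]
  let qc : Quad n g → K := fun q => col q.1.1 q.1.2 q.2.1 q.2.2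
  let S : K → Finset (Quad n g) := fun c => (quads n g).filter (fun q => qc q = c)
  have memS : ∀ c (i j : Fin n) (a b : Fin g), ((i, j), (a, b)) ∈ S c ↔ i < j ∧ col i j a b = c := by
    intro c i j a b
    simp [S, quads, qc]
  -- upper bound
  have hub : ∀ c, (S c).card ≤ s := by
    intro c
    have : ((S c) ×ˢ (Finset.univ : Finset Bool)).card ≤
        (Finset.univ : Finset (Fin n × Fin g)).card := by
      apply Finset.card_le_card_of_injOn
        (fun p => if p.2 then (p.1.1.1, p.1.2.1) else (p.1.1.2, p.1.2.2)) (by simp)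
      rintro ⟨⟨⟨i, j⟩, a, b⟩, t⟩ hp ⟨⟨⟨i', j'⟩, a', b'⟩, t'⟩ hp' he
      simp only [Finset.coe_product, Set.mem_prod, Finset.mem_coe, memS] at hp hp'
      obtain ⟨⟨hl, hc⟩, -⟩ := hp
      obtain ⟨⟨hl', hc'⟩, -⟩ := hp'
      have hsw := h2 i j a b hl.ne
      have hsw' := h2 i' j' a' b' hl'.ne
      cases t <;> cases t' <;> simp at he <;> obtain ⟨rfl, rfl⟩ := he
      · have := h3 _ _ _ _ _ _ hl.ne' hl'.ne' (by rw [← hsw, ← hsw', hc, hc'])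
        simp [this]
      · have := h3 _ _ _ _ _ _ hl.ne' hl'.ne (by rw [← hsw, hc, hc'])
        omega
      · have := h3 _ _ _ _ _ _ hl.ne hl'.ne' (by rw [← hsw', hc, hc'])
        omega
      · have := h3 _ _ _ _ _ _ hl.ne hl'.ne (by rw [hc, hc'])
        simp [this]
    simp only [Finset.card_product, Finset.card_univ, Fintype.card_bool, Fintype.card_prod,
      Fintype.card_fin] at this
    have := mul_comm n g
    omega
  have hsum : ∑ c ∈ C, (S c).card = ∑ c ∈ C, s := by
    have h5 : (quads n g).card = ∑ c ∈ C, (S c).card := by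
      apply Finset.card_eq_sum_card_fiberwise
      rintro ⟨⟨i, j⟩, a, b⟩ hq
      simp only [quads, Finset.coe_filter, Finset.mem_univ, true_and, Set.mem_setOf_eq] at hq
      exact h1 _ _ _ _ hq.ne
    rw [← h5, Finset.sum_const, h0, smul_eq_mul]
    have := quads_card n g
    rw [hs] at this
    nlinarith
  have heq : ∀ c ∈ C, (S c).card = s := (Finset.sum_eq_sum_iff_of_le (fun c _ => hub c)).1 hsum
  let e : Fin (g * (n - 1)) ≃ C := (Fintype.equivFinOfCardEq (by simpa using h0)).symm
  have hSq : ∀ c q, q ∈ S c → q ∈ quads n g := fun c q h => (Finset.mem_filter.1 h).1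
  have hSc : ∀ c q, q ∈ S c → qc q = c := fun c q h => (Finset.mem_filter.1 h).2
  refine ⟨fun t => (S (e t)).image qword, ?_, ?_, ?_, ?_⟩
  · intro t t' htt
    rw [Finset.disjoint_left]
    intro x hx hx'
    obtain ⟨q, hq, rfl⟩ := Finset.mem_image.1 hx
    obtain ⟨r, hr, hqr⟩ := Finset.mem_image.1 hx'
    have := qword_inj (hSq _ _ hr) (hSq _ _ hq) hqr
    subst this
    apply htt
    apply e.injective
    apply Subtype.ext
    rw [← hSc _ _ hq, ← hSc _ _ hr]
  · rw [← image_quads]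
    ext x
    simp only [Finset.mem_biUnion, Finset.mem_univ, true_and, Finset.mem_image]
    constructor
    · rintro ⟨t, q, hq, rfl⟩
      exact ⟨q, hSq _ _ hq, rfl⟩
    · rintro ⟨q, hq, rfl⟩
      have hqC : qc q ∈ C := by
        obtain ⟨⟨i, j⟩, a, b⟩ := q
        simp only [quads, Finset.mem_filter, Finset.mem_univ, true_and] at hq
        exact h1 _ _ _ _ hq.ne
      exact ⟨e.symm ⟨qc q, hqC⟩, q, by simp [S, hq], rfl⟩
  · intro t
    rw [Finset.card_image_of_injOn, heq _ (e t).2]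
    intro q hq r hr h
    exact qword_inj (hSq _ _ hq) (hSq _ _ hr) h
  · intro t x hx y hy hxy
    obtain ⟨⟨⟨i, j⟩, a, b⟩, hq, rfl⟩ := Finset.mem_image.1 hx
    obtain ⟨⟨⟨i', j'⟩, a', b'⟩, hr, rfl⟩ := Finset.mem_image.1 hy
    rw [memS] at hq hr
    obtain ⟨hl, hc⟩ := hq
    obtain ⟨hl', hc'⟩ := hr
    have hsw := h2 i j a b hl.ne
    have hsw' := h2 i' j' a' b' hl'.ne
    simp only [qword] at hxy ⊢
    by_cases e1 : i = i'
    · subst e1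
      by_cases e2 : j = j'
      · subst e2
        obtain ⟨rfl, rfl⟩ := h4 _ _ _ _ _ _ hl.ne (hc.trans hc'.symm)
        exact absurd rfl hxy
      · refine dist_share _ _ _ _ _ _ _ hl.ne hl'.ne e2 ?_
        rintro rfl
        exact e2 (h3 _ _ _ _ _ _ hl.ne hl'.ne (hc.trans hc'.symm)).1
    · by_cases e2 : j = j'
      · subst e2
        rw [word_comm i j _ _ hl.ne, word_comm i' j _ _ hl'.ne]
        refine dist_share _ _ _ _ _ _ _ hl.ne' hl'.ne' e1 ?_
        rintro rfl
        exact e1 (h3 _ _ _ _ _ _ hl.ne' hl'.ne' (by rw [← hsw, ← hsw', hc, hc'])).1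
      · by_cases e3 : i = j'
        · subst e3
          have hne : j ≠ i' := by omega
          rw [word_comm i' i _ _ hl'.ne]
          refine dist_share _ _ _ _ _ _ _ hl.ne hl'.ne' hne ?_
          rintro rfl
          exact hne (h3 _ _ _ _ _ _ hl.ne hl'.ne' (by rw [← hsw', hc, hc'])).1
        · by_cases e4 : j = i'
          · subst e4
            have hne : i ≠ j' := by omega
            rw [word_comm i j _ _ hl.ne]
            refine dist_share _ _ _ _ _ _ _ hl.ne' hl'.ne hne ?_
            rintro rfl
            exact hne (h3 _ _ _ _ _ _ hl.ne' hl'.ne (by rw [← hsw, hc, hc'])).1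
          · exact dist_disj _ _ _ _ _ _ _ _ hl.ne e1 e3 e4 e2

theorem isOF_of_good (n g : ℕ) [NeZero n] [NeZero g] (he : Even (g * n)) (H : Good g n) :
    IsOF n g :=
  isOF_of_pcol n g he (H.transport (Fintype.equivOfCardEq (by simp [ZMod.card]))
    (Fintype.equivOfCardEq (by simp [ZMod.card])))

theorem even_of_isOF (n g : ℕ) (hn : 2 ≤ n) (hg : 1 ≤ g) (H : IsOF n g) : Even (g * n) := by
  obtain ⟨P, hd, hu, hc, -⟩ := H
  have h1 := Finset.card_biUnion (s := Finset.univ) (t := P) (fun i _ j _ hij => hd i j hij)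
  rw [hu] at h1
  simp only [hc, Finset.sum_const, Finset.card_univ, Fintype.card_fin, smul_eq_mul] at h1
  have h2 := card_weightTwo n g
  rw [h1] at h2
  have hpos : 0 < g * (n - 1) := Nat.mul_pos hg (by omega)
  have : 2 * (g * n / 2) = g * n := by
    apply Nat.eq_of_mul_eq_mul_left hpos
    rw [← h2]; ring
  exact ⟨g * n / 2, by omega⟩

theorem not_isOF_two (g : ℕ) (hg : 2 ≤ g) : ¬ IsOF 2 g := by
  rintro ⟨P, -, -, hc, hdist⟩
  have h0 : 0 < g * (2 - 1) := by omega
  have h1 := hc ⟨0, h0⟩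
  have h2 : 1 < (P ⟨0, h0⟩).card := by rw [h1]; omega
  obtain ⟨x, hx, y, hy, hxy⟩ := Finset.one_lt_card.1 h2
  have h3 := hdist _ x hx y hy hxy
  have h4 := hammingDist_le_card_fintype (x := x) (y := y)
  simp at h4
  omega

theorem OF_iff_g_two_three (n g : ℕ) (hg : g = 2 ∨ g = 3) (hn : 2 ≤ n) :
    IsOF n g ↔ (g < n ∧ Even (g * n)) := by
  have : NeZero n := ⟨by omega⟩
  constructor
  · intro H
    have he := even_of_isOF n g hn (by omega) H
    refine ⟨?_, he⟩
    by_contra hlt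
    have h2 : n ≠ 2 := by
      rintro rfl
      exact not_isOF_two g (by omega) H
    obtain rfl : n = 3 := by omega
    obtain rfl : g = 3 := by omega
    exact absurd he (by decide)
  · rintro ⟨hlt, he⟩
    rcases hg with rfl | rfl
    · exact isOF_of_good n 2 he (good_two n hlt)
    · refine isOF_of_good n 3 he (good_three n hlt ?_)
      rcases Nat.even_mul.1 he with h | h
      · exact absurd h (by decide)
      · exact h
end
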